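/- arXiv:math/0410053 — 2 statements merged into one kernel-verified Lean document; each statement's English description precedes it below -/
import Mathlib

section
/- Let μ_α and μ_β be linear functionals on Pol^{k−2}(ℚ_p, L). The following are equivalent: (i) for every j ∈ {0,…,k−2}, every y ∈ ℚ_p^× and every integer N > val(y), μ_β(1_{p^{−N}ℤ_p}(z)·z^j·ε(zy)) = (β/α)^{val(y)} · μ_α(1_{p^{−N}ℤ_p}(z)·z^j·ε(zy)) (identities in the algebraic closure of ℚ_p, after extending μ_α and μ_β by linearity to functions with values in it); (ii) for every f ∈ Pol^{k−2}(ℚ_p, L), written uniquely as f(z) = Σ_{j=0}^{k−2} z^j h_j(z) with each h_j : ℚ_p → L locally constant and compactly supported, such that ∫_{ℚ_p} h_j(x) dx = 0 for every j (equivalently, such that I(f) is compactly supported), one has μ_β(f) = ((1 − α/β)/(1 − β/(pα))) · μ_α(I(f)), where I(f)(z) := Σ_{j=0}^{k−2} z^j ∫_{ℚ_p} (pα/β)^{val(z−x)} h_j(x) dx (a convergent integral, with I(f) ∈ Pol^{k−2}(ℚ_p, L)). -/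
open Filter Topology Classical

noncomputable section

namespace Paper

variable (p : ℕ) [Fact p.Prime]
variable (L : Type) [NontriviallyNormedField L] [NormedAlgebra ℚ_[p] L]

/-- The canonical embedding `ℚ_p → L`. -/
noncomputable def iotaL : ℚ_[p] → L := algebraMap ℚ_[p] L

/-- The binomial coefficient `binom(z, n) = z(z-1)⋯(z-n+1)/n!` of a `p`-adic
integer, computed in `ℚ_p`. -/
noncomputable def binomQ (z : ℤ_[p]) (n : ℕ) : ℚ_[p] :=
  (∏ i ∈ Finset.range n, ((z : ℚ_[p]) - (i : ℚ_[p]))) / (n.factorial : ℚ_[p])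

/-- The Mahler coefficients `a_n(f) = ∑_{i=0}^n (-1)^i binom(n,i) f(n-i)`. -/
noncomputable def mahlerCoeff (f : ℤ_[p] → L) (n : ℕ) : L :=
  ∑ i ∈ Finset.range (n + 1), (-1 : L) ^ i * (n.choose i : L) * f (((n - i : ℕ) : ℤ_[p]))

/-- `f : ℤ_p → L` is of class `C^r` : the scaled Mahler coefficients
`n^r a_n(f)` tend to `0`, and `f` is the sum of its Mahler expansion. -/
def IsCr (r : ℝ) (f : ℤ_[p] → L) : Prop :=
  Tendsto (fun n : ℕ => (n : ℝ) ^ r * ‖mahlerCoeff p L f n‖) atTop (nhds 0) ∧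
  ∀ z : ℤ_[p], HasSum (fun n : ℕ => mahlerCoeff p L f n * iotaL p L (binomQ p z n)) (f z)

/-- The norm `‖f‖_r = sup_n (n+1)^r ‖a_n(f)‖` on `C^r(ℤ_p, L)`. -/
noncomputable def crNorm (r : ℝ) (f : ℤ_[p] → L) : ℝ :=
  ⨆ n : ℕ, ((n : ℝ) + 1) ^ r * ‖mahlerCoeff p L f n‖

/-- A continuous (= bounded) linear functional on `C^r(ℤ_p, L)`, i.e. a tempered
distribution of order `r`. -/
structure CrDual (r : ℝ) where
  toFun : (ℤ_[p] → L) → L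
  map_add' : ∀ f g : ℤ_[p] → L, IsCr p L r f → IsCr p L r g →
    toFun (f + g) = toFun f + toFun g
  map_smul' : ∀ (c : L) (f : ℤ_[p] → L), IsCr p L r f → toFun (c • f) = c * toFun f
  bound' : ∃ C : ℝ, ∀ f : ℤ_[p] → L, IsCr p L r f → ‖toFun f‖ ≤ C * crNorm p L r f

/-- The function `z ↦ 1_{a + pⁿℤ_p}(z) (z - a)^j`. -/
noncomputable def indPoly (a : ℤ_[p]) (n : ℕ) (j : ℕ) : ℤ_[p] → L := fun z =>
  if ‖z - a‖ ≤ (p : ℝ) ^ (-(n : ℤ)) then (iotaL p L ((z : ℚ_[p]) - (a : ℚ_[p]))) ^ j else 0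

/-- The norm `‖μ‖_{r,d} = sup_{a, 0 ≤ j ≤ d, n} p^{n(j-r)} ‖∫_{a+pⁿℤ_p} (z-a)^j dμ‖`. -/
noncomputable def dualNormRD (r : ℝ) (d : ℕ) (μ : CrDual p L r) : ℝ :=
  ⨆ (a : ℤ_[p]) (j : Fin (d + 1)) (n : ℕ),
    (p : ℝ) ^ ((n : ℝ) * (((j : ℕ) : ℝ) - r)) * ‖μ.toFun (indPoly p L a n j)‖

/-- `f : ℤ_p → L` is locally polynomial of local degree at most `d`. -/
def IsLocPoly (d : ℕ) (f : ℤ_[p] → L) : Prop :=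
  ∃ n : ℕ, ∀ a : ℤ_[p], ∃ P : Polynomial L, P.natDegree ≤ d ∧
    ∀ z : ℤ_[p], ‖z - a‖ ≤ (p : ℝ) ^ (-(n : ℤ)) → f z = Polynomial.eval (iotaL p L (z : ℚ_[p])) P

/-- A linear functional on `Pol^d(ℤ_p, L)`. -/
structure PolDual (d : ℕ) where
  toFun : (ℤ_[p] → L) → L
  map_add' : ∀ f g : ℤ_[p] → L, IsLocPoly p L d f → IsLocPoly p L d g →
    toFun (f + g) = toFun f + toFun g
  map_smul' : ∀ (c : L) (f : ℤ_[p] → L), IsLocPoly p L d f → toFun (c • f) = c * toFun f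

/-- The valuation `val(x) = -log_p ‖x‖` on `L`, normalized by `val(p) = 1`. -/
noncomputable def valL (x : L) : ℝ := -Real.logb p ‖x‖

/-- `g : ℤ_p → L` is a class-`C^{val α}` extension of
`z ↦ (αp/β)^{val z} z^{k-2} f(1/z)` from `ℤ_p ∖ {0}` to `ℤ_p`. -/
def Ext2 (k : ℕ) (α β : L) (f : ℚ_[p] → L) (g : ℤ_[p] → L) : Prop :=
  IsCr p L (valL p L α) g ∧ ∀ z : ℤ_[p], z ≠ 0 →
    g z = (α * (p : L) / β) ^ ((z : ℚ_[p]).valuation) *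
      (iotaL p L (z : ℚ_[p])) ^ (k - 2) * f (((z : ℚ_[p]))⁻¹)

/-- Membership in the Banach space `B(α)`. -/
def MemB (k : ℕ) (α β : L) (f : ℚ_[p] → L) : Prop :=
  IsCr p L (valL p L α) (fun z : ℤ_[p] => f ((p : ℚ_[p]) * (z : ℚ_[p]))) ∧
  ∃ g : ℤ_[p] → L, Ext2 p L k α β f g

/-- The extension `f₂` of `z ↦ (αp/β)^{val z} z^{k-2} f(1/z)` to `ℤ_p`
(it is unique when it exists). -/
noncomputable def ext2 (k : ℕ) (α β : L) (f : ℚ_[p] → L) : ℤ_[p] → L :=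
  if h : ∃ g : ℤ_[p] → L, Ext2 p L k α β f g then h.choose else 0

/-- The norm `‖f‖ = max(‖f₁‖_{val α}, ‖f₂‖_{val α})` on `B(α)`. -/
noncomputable def bNorm (k : ℕ) (α β : L) (f : ℚ_[p] → L) : ℝ :=
  max (crNorm p L (valL p L α) (fun z : ℤ_[p] => f ((p : ℚ_[p]) * (z : ℚ_[p]))))
      (crNorm p L (valL p L α) (ext2 p L k α β f))

/-- Determinant of a 2×2 matrix. -/
noncomputable def det2 (m : Matrix (Fin 2) (Fin 2) ℚ_[p]) : ℚ_[p] :=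
  m 0 0 * m 1 1 - m 0 1 * m 1 0

/-- The action of `g = (a b; c d) ∈ GL₂(ℚ_p)` on `B(α)`:
`(g·f)(z) = α^{-val(ad-bc)} (αp/β)^{val(-cz+a)} (-cz+a)^{k-2} f((dz-b)/(-cz+a))`,
the value at the pole `-cz+a = 0` being the one prescribed by the extension `f₂`. -/
noncomputable def gAct (k : ℕ) (α β : L) (m : Matrix (Fin 2) (Fin 2) ℚ_[p])
    (f : ℚ_[p] → L) : ℚ_[p] → L := fun z =>
  if -(m 1 0) * z + m 0 0 = 0 then
    α ^ (-(det2 p m).valuation) * (α * (p : L) / β) ^ ((det2 p m / m 1 0).valuation) *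
      (iotaL p L (det2 p m / m 1 0)) ^ (k - 2) * ext2 p L k α β f 0
  else
    α ^ (-(det2 p m).valuation) * (α * (p : L) / β) ^ ((-(m 1 0) * z + m 0 0).valuation) *
      (iotaL p L (-(m 1 0) * z + m 0 0)) ^ (k - 2) *
      f ((m 1 1 * z - m 0 1) / (-(m 1 0) * z + m 0 0))

/-- The monomial function `z ↦ z^j` on `ℚ_p`. -/
noncomputable def monomialFun (j : ℕ) : ℚ_[p] → L := fun z => (iotaL p L z) ^ j

/-- The function `z ↦ (αp/β)^{val(z-a)} (z-a)^{k-2-j}` (extended by `0` at `z = a`). -/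
noncomputable def specFun (k : ℕ) (α β : L) (a : ℚ_[p]) (j : ℕ) : ℚ_[p] → L := fun z =>
  if z = a then 0 else
    (α * (p : L) / β) ^ ((z - a).valuation) * (iotaL p L (z - a)) ^ (k - 2 - j)

/-- The generators of `L(α)` : the functions `z^j` and
`(αp/β)^{val(z-a)}(z-a)^{k-2-j}` for `0 ≤ j < val(α)` and `a ∈ ℚ_p`. -/
def lGen (k : ℕ) (α β : L) : Set (ℚ_[p] → L) :=
  {f | ∃ j : ℕ, (j : ℝ) < valL p L α ∧
    (f = monomialFun p L j ∨ ∃ a : ℚ_[p], f = specFun p L k α β a j)}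

/-- Membership in `L(α)`, the closure in `B(α)` of the span of the special
functions. -/
def MemLalpha (k : ℕ) (α β : L) (f : ℚ_[p] → L) : Prop :=
  MemB p L k α β f ∧ ∀ ε : ℝ, 0 < ε →
    ∃ g ∈ Submodule.span L (lGen p L k α β), bNorm p L k α β (f - g) < ε

/-- The quotient (semi)norm on `Π(V) = B(α)/L(α)`. -/
noncomputable def qNorm (k : ℕ) (α β : L) (f : ℚ_[p] → L) : ℝ :=
  sInf {x : ℝ | ∃ g : ℚ_[p] → L, MemLalpha p L k α β g ∧ x = bNorm p L k α β (f - g)}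

/-- `h : ℚ_p → L` is locally constant. -/
def LocConst (h : ℚ_[p] → L) : Prop :=
  ∀ x : ℚ_[p], ∃ n : ℕ, ∀ y : ℚ_[p], ‖y - x‖ ≤ (p : ℝ) ^ (-(n : ℤ)) → h y = h x

/-- `h` belongs to the smooth induced representation: `h` is locally constant and
`z ↦ (αp/β)^{val z} h(1/z)` extends to a locally constant function on `ℚ_p`. -/
def IndCond (α β : L) (h : ℚ_[p] → L) : Prop :=
  LocConst p L h ∧ ∃ h' : ℚ_[p] → L, LocConst p L h' ∧
    ∀ z : ℚ_[p], z ≠ 0 → h' z = (α * (p : L) / β) ^ z.valuation * h z⁻¹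

/-- The generators `z ↦ P(z) h(z)` of the locally algebraic representation `π(α)`. -/
def piGen (k : ℕ) (α β : L) : Set (ℚ_[p] → L) :=
  {f | ∃ (P : Polynomial L) (h : ℚ_[p] → L), P.natDegree ≤ k - 2 ∧ IndCond p L α β h ∧
    f = fun z => Polynomial.eval (iotaL p L z) P * h z}

/-- The locally algebraic representation `π(α)`, as a subspace of functions
`ℚ_p → L`. -/
noncomputable def piRep (k : ℕ) (α β : L) : Submodule L (ℚ_[p] → L) :=
  Submodule.span L (piGen p L k α β)

/-- The standing hypotheses on `(k, α, β)` coming from an absolutely irreducible,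
`φ`-semisimple crystalline representation: `k ≥ 2`, `α ≠ β`,
`0 < val(β) ≤ val(α)` and `val(α) + val(β) = k - 1`. -/
def Hyps (k : ℕ) (α β : L) : Prop :=
  2 ≤ k ∧ α ≠ β ∧ 0 < valL p L α ∧ 0 < valL p L β ∧
    valL p L α + valL p L β = (k : ℝ) - 1 ∧ valL p L β ≤ valL p L α

/-- `Λ` is a `GL₂(ℚ_p)`-stable `𝒪_L`-lattice in `π(α)`: an `𝒪_L`-submodule of
`π(α)` generating it over `L`, containing no `L`-line and stable by the action. -/
def IsLatticeStable (k : ℕ) (α β : L) (Λ : Set (ℚ_[p] → L)) : Prop :=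
  (∀ f ∈ Λ, f ∈ piRep p L k α β) ∧ ((0 : ℚ_[p] → L) ∈ Λ) ∧
  (∀ f ∈ Λ, ∀ g ∈ Λ, f + g ∈ Λ) ∧
  (∀ c : L, ‖c‖ ≤ 1 → ∀ f ∈ Λ, c • f ∈ Λ) ∧
  (∀ f ∈ piRep p L k α β, ∃ c : L, c ≠ 0 ∧ c • f ∈ Λ) ∧
  (∀ f, f ∈ piRep p L k α β → f ≠ 0 → ¬ ∀ c : L, c • f ∈ Λ) ∧
  (∀ m : Matrix (Fin 2) (Fin 2) ℚ_[p], det2 p m ≠ 0 → ∀ f ∈ Λ, gAct p L k α β m f ∈ Λ)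

/-- `f : ℚ_p → L` is a compactly supported locally polynomial function of local
degree at most `d` (an element of `Pol^d(ℚ_p, L)`). -/
def IsPolC (d : ℕ) (f : ℚ_[p] → L) : Prop :=
  ∃ N : ℕ, (∀ z : ℚ_[p], (p : ℝ) ^ (N : ℤ) < ‖z‖ → f z = 0) ∧
    ∀ a : ℚ_[p], ∃ P : Polynomial L, P.natDegree ≤ d ∧
      ∀ z : ℚ_[p], ‖z - a‖ ≤ (p : ℝ) ^ (-(N : ℤ)) → f z = Polynomial.eval (iotaL p L z) P

/-- A linear functional on `Pol^d(ℚ_p, L)`. -/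
structure PolCDual (d : ℕ) where
  toFun : (ℚ_[p] → L) → L
  map_add' : ∀ f g : ℚ_[p] → L, IsPolC p L d f → IsPolC p L d g →
    toFun (f + g) = toFun f + toFun g
  map_smul' : ∀ (c : L) (f : ℚ_[p] → L), IsPolC p L d f → toFun (c • f) = c * toFun f

/-- The (regularized) integral `∫_{ℚ_p} (pα/β)^{val(z-x)} h(x) dx`, for `h`
supported in `p^{-N}ℤ_p` and constant on cosets of `p^Nℤ_p`, computed coset by
coset (the contribution of the coset of `z` being the sum
`(1 - 1/p) ∑_{m ≥ N} (α/β)^m = (1 - 1/p)(α/β)^N/(1 - α/β)`). -/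
noncomputable def iInt (α β : L) (h : ℚ_[p] → L) (N : ℕ) (z : ℚ_[p]) : L :=
  ∑ c ∈ Finset.range (p ^ (2 * N)),
    if ‖z - (p : ℚ_[p]) ^ (-(N : ℤ)) * (c : ℚ_[p])‖ ≤ (p : ℝ) ^ (-(N : ℤ)) then
      h z * ((1 - (p : L)⁻¹) * (α / β) ^ N / (1 - α / β))
    else
      h ((p : ℚ_[p]) ^ (-(N : ℤ)) * (c : ℚ_[p])) *
        (α * (p : L) / β) ^ ((z - (p : ℚ_[p]) ^ (-(N : ℤ)) * (c : ℚ_[p])).valuation) *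
        (p : L) ^ (-(N : ℤ))

/-- The value `∫_{p^{-N}ℤ_p} z^j ε(zy) dμ(z)`, computed in a field `E`
containing (an image of) `L` and the values of the additive character `ε`, by
decomposing `p^{-N}ℤ_p` into cosets on which `z ↦ ε(zy)` is constant. -/
noncomputable def charInt (E : Type) [NontriviallyNormedField E] [NormedAlgebra ℚ_[p] E]
    (σ : L →+* E) (ε : ℚ_[p] → E) (d : ℕ) (μ : PolCDual p L d)
    (j : ℕ) (y : ℚ_[p]) (N : ℤ) : E :=
  ∑ c ∈ Finset.range (p ^ ((max N (-y.valuation) + N).toNat)),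
    ε ((p : ℚ_[p]) ^ (-N) * (c : ℚ_[p]) * y) *
      σ (μ.toFun (fun z =>
        if ‖z - (p : ℚ_[p]) ^ (-N) * (c : ℚ_[p])‖ ≤ (p : ℝ) ^ (-(max N (-y.valuation))) then
          (iotaL p L z) ^ j else 0))

section Helpers

variable {p} {L}

/-- The point `p^{-N} c` of `p^{-N}ℤ_p`. -/
def node (p : ℕ) [Fact p.Prime] (N : ℤ) (c : ℕ) : ℚ_[p] := (p : ℚ_[p]) ^ (-N) * (c : ℚ_[p])

lemma one_lt_cast_prime : (1 : ℝ) < p := by exact_mod_cast (Fact.out : p.Prime).one_lt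

lemma cast_prime_pos : (0 : ℝ) < p := lt_trans zero_lt_one one_lt_cast_prime

lemma norm_add_le_of_le {x y : ℚ_[p]} {r : ℝ} (hx : ‖x‖ ≤ r) (hy : ‖y‖ ≤ r) : ‖x + y‖ ≤ r :=
  (Padic.nonarchimedean x y).trans (max_le hx hy)

lemma norm_sub_le_of_le {x y : ℚ_[p]} {r : ℝ} (hx : ‖x‖ ≤ r) (hy : ‖y‖ ≤ r) : ‖x - y‖ ≤ r := by
  rw [sub_eq_add_neg]
  exact norm_add_le_of_le hx (by rwa [norm_neg])

lemma norm_node_le (N : ℤ) (c : ℕ) : ‖node p N c‖ ≤ (p : ℝ) ^ N := by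
  have h : ‖(c : ℚ_[p])‖ ≤ 1 := by exact_mod_cast Padic.norm_int_le_one (p := p) (c : ℤ)
  rw [node, norm_mul, Padic.norm_p_zpow, neg_neg]
  exact mul_le_of_le_one_right (zpow_nonneg cast_prime_pos.le _) h

lemma norm_le_zpow_mul_iff (M N : ℤ) (x : ℚ_[p]) :
    ‖x‖ ≤ (p : ℝ) ^ M ↔ ‖(p : ℚ_[p]) ^ N * x‖ ≤ (p : ℝ) ^ (M - N) := by
  rw [norm_mul, Padic.norm_p_zpow, zpow_sub₀ cast_prime_pos.ne', zpow_neg, div_eq_inv_mul]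
  exact (mul_le_mul_iff_right₀ (inv_pos.2 (zpow_pos cast_prime_pos _))).symm

lemma zpow_mul_node (N : ℤ) (c : ℕ) : (p : ℚ_[p]) ^ N * node p N c = c := by
  have hp : (p : ℚ_[p]) ≠ 0 := by exact_mod_cast (Fact.out : p.Prime).ne_zero
  rw [node, zpow_neg, mul_inv_cancel_left₀ (zpow_ne_zero _ hp)]

lemma exists_node_near {M N : ℤ} {K : ℕ} (hK : (K : ℤ) = M + N) {x : ℚ_[p]}
    (hx : ‖x‖ ≤ (p : ℝ) ^ N) :
    ∃ c ∈ Finset.range (p ^ K), ‖x - node p N c‖ ≤ (p : ℝ) ^ (-M) := by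
  have hu : ‖(p : ℚ_[p]) ^ N * x‖ ≤ 1 := by
    simpa using (norm_le_zpow_mul_iff N N x).1 hx
  set u : ℤ_[p] := ⟨_, hu⟩ with hudef
  refine ⟨u.appr K, Finset.mem_range.2 (u.appr_lt K), ?_⟩
  have h1 := (PadicInt.norm_le_pow_iff_mem_span_pow _ K).2 (PadicInt.appr_spec K u)
  rw [norm_le_zpow_mul_iff (-M) N, mul_sub, zpow_mul_node,
    show -M - N = -(K : ℤ) by omega]
  exact_mod_cast h1

lemma node_near_unique {M N : ℤ} {K : ℕ} (hK : (K : ℤ) = M + N) {x : ℚ_[p]} {c d : ℕ}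
    (hc : c ∈ Finset.range (p ^ K)) (hd : d ∈ Finset.range (p ^ K))
    (hxc : ‖x - node p N c‖ ≤ (p : ℝ) ^ (-M)) (hxd : ‖x - node p N d‖ ≤ (p : ℝ) ^ (-M)) :
    c = d := by
  have h := norm_sub_le_of_le hxd hxc
  rw [sub_sub_sub_cancel_left, norm_le_zpow_mul_iff (-M) N, mul_sub, zpow_mul_node, zpow_mul_node,
    show -M - N = -(K : ℤ) by omega] at h
  have h2 : ((p ^ K : ℕ) : ℤ) ∣ (c : ℤ) - d := by
    have := (Padic.norm_int_le_pow_iff_dvd (p := p) ((c : ℤ) - d) K).1 (by push_cast; exact h)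
    exact_mod_cast this
  have h3 := (Nat.modEq_iff_dvd.2 h2)
  exact (Nat.ModEq.eq_of_lt_of_lt h3 (Finset.mem_range.1 hd) (Finset.mem_range.1 hc)).symm

/-- A function invariant under `p^M ℤ_p` is recovered from its values at the nodes. -/
lemma sum_nodes_ball {R : Type*} [AddCommMonoid R] {M N : ℤ} {K : ℕ} (hK : (K : ℤ) = M + N)
    (x : ℚ_[p]) {g : ℚ_[p] → R} (hg : ∀ z w : ℚ_[p], ‖z - w‖ ≤ (p : ℝ) ^ (-M) → g z = g w) :
    (∑ c ∈ Finset.range (p ^ K),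
      if ‖x - node p N c‖ ≤ (p : ℝ) ^ (-M) then g (node p N c) else 0)
      = if ‖x‖ ≤ (p : ℝ) ^ N then g x else 0 := by
  split_ifs with hx
  · obtain ⟨c, hc, hxc⟩ := exists_node_near hK hx
    rw [Finset.sum_eq_single_of_mem c hc, if_pos hxc, hg _ _ hxc]
    intro d hd hne
    exact if_neg fun hxd => hne (node_near_unique hK hd hc hxd hxc)
  · refine Finset.sum_eq_zero fun c _ => if_neg fun hxc => hx ?_
    have h : (p : ℝ) ^ (-M) ≤ (p : ℝ) ^ N := zpow_le_zpow_right₀ one_lt_cast_prime.le (by omega)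
    simpa using norm_add_le_of_le (hxc.trans h) (norm_node_le N c)

lemma two_mul_cast (n : ℕ) : ((2 * n : ℕ) : ℤ) = (n : ℤ) + n := by push_cast; ring

/-- Translation invariance of the sum over the nodes of level `n`. -/
lemma sum_nodes_translate {R : Type*} [AddCommMonoid R] (n : ℕ) {t : ℚ_[p]}
    (ht : ‖t‖ ≤ (p : ℝ) ^ (n : ℤ)) {F : ℚ_[p] → R}
    (hF : ∀ z w : ℚ_[p], ‖z - w‖ ≤ (p : ℝ) ^ (-(n : ℤ)) → F z = F w) :
    ∑ c ∈ Finset.range (p ^ (2 * n)), F (node p n c + t)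
      = ∑ c ∈ Finset.range (p ^ (2 * n)), F (node p n c) := by
  have h1 : ∀ c : ℕ, F (node p n c + t) = ∑ d ∈ Finset.range (p ^ (2 * n)),
      if ‖node p n c + t - node p n d‖ ≤ (p : ℝ) ^ (-(n : ℤ)) then F (node p n d) else 0 := by
    intro c
    rw [sum_nodes_ball (two_mul_cast n) _ hF, if_pos (norm_add_le_of_le (norm_node_le _ _) ht)]
  have h2 : ∀ d : ℕ, F (node p n d) = ∑ c ∈ Finset.range (p ^ (2 * n)),
      if ‖node p n c + t - node p n d‖ ≤ (p : ℝ) ^ (-(n : ℤ)) then F (node p n d) else 0 := by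
    intro d
    have := sum_nodes_ball (two_mul_cast n) (node p n d - t)
      (g := fun _ => F (node p n d)) (fun _ _ _ => rfl)
    rw [if_pos (norm_sub_le_of_le (norm_node_le _ _) ht)] at this
    refine this.symm.trans (Finset.sum_congr rfl fun c _ => ?_)
    rw [show node p n d - t - node p n c = -(node p n c + t - node p n d) by ring, norm_neg]
  rw [Finset.sum_congr rfl fun c _ => h1 c, Finset.sum_comm]
  exact (Finset.sum_congr rfl fun d _ => h2 d).symm

lemma norm_le_iff_of_near {m n : ℤ} (hmn : m ≤ n) {z w : ℚ_[p]}
    (h : ‖z - w‖ ≤ (p : ℝ) ^ (-n)) : ‖z‖ ≤ (p : ℝ) ^ (-m) ↔ ‖w‖ ≤ (p : ℝ) ^ (-m) := by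
  have h' : ‖z - w‖ ≤ (p : ℝ) ^ (-m) :=
    h.trans (zpow_le_zpow_right₀ one_lt_cast_prime.le (by omega))
  constructor <;> intro hz
  · simpa using norm_sub_le_of_le hz h'
  · simpa using norm_add_le_of_le h' hz

/-- The number of nodes of level `n` in a ball of radius `p^{-m}`. -/
lemma card_nodes_ball {E : Type*} [Field E] [CharZero E] (n : ℕ) {m : ℤ} (h1 : -(n : ℤ) ≤ m)
    (h2 : m ≤ n) {x : ℚ_[p]} (hx : ‖x‖ ≤ (p : ℝ) ^ (n : ℤ)) :
    (∑ c ∈ Finset.range (p ^ (2 * n)), if ‖x - node p n c‖ ≤ (p : ℝ) ^ (-m) then (1 : E) else 0)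
      = (p : E) ^ ((n : ℤ) - m) := by
  have hp : (p : E) ≠ 0 := by exact_mod_cast (Fact.out : p.Prime).ne_zero
  set F : ℚ_[p] → E := fun z => if ‖z‖ ≤ (p : ℝ) ^ (-m) then 1 else 0 with hFdef
  have hF : ∀ z w : ℚ_[p], ‖z - w‖ ≤ (p : ℝ) ^ (-(n : ℤ)) → F z = F w := by
    intro z w h
    simp only [hFdef, norm_le_iff_of_near h2 h]
  have hsym : ∀ z w : ℚ_[p], ‖z - w‖ = ‖w + -z‖ := fun z w => by
    rw [← norm_neg]; congr 1; ring
  have hconst : ∀ y : ℚ_[p], ‖y‖ ≤ (p : ℝ) ^ (n : ℤ) →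
      (∑ c ∈ Finset.range (p ^ (2 * n)),
        if ‖y - node p n c‖ ≤ (p : ℝ) ^ (-m) then (1 : E) else 0)
        = ∑ c ∈ Finset.range (p ^ (2 * n)), F (node p n c) := by
    intro y hy
    rw [← sum_nodes_translate n (t := -y) (by rwa [norm_neg]) hF]
    refine Finset.sum_congr rfl fun c _ => ?_
    simp only [hFdef, hsym]
  obtain ⟨K, hK⟩ := Int.eq_ofNat_of_zero_le (show 0 ≤ m + n by omega)
  have htot : ∑ d ∈ Finset.range (p ^ K), ∑ c ∈ Finset.range (p ^ (2 * n)),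
      (if ‖node p n d - node p n c‖ ≤ (p : ℝ) ^ (-m) then (1 : E) else 0)
      = (p : E) ^ (2 * n) := by
    rw [Finset.sum_comm]
    have : ∀ c ∈ Finset.range (p ^ (2 * n)), ∑ d ∈ Finset.range (p ^ K),
        (if ‖node p n d - node p n c‖ ≤ (p : ℝ) ^ (-m) then (1 : E) else 0) = 1 := by
      intro c _
      have h := sum_nodes_ball (M := m) (N := n) hK.symm (node p n c) (g := fun _ => (1 : E))
        (fun _ _ _ => rfl)
      rw [if_pos (norm_node_le _ _)] at h
      refine (Finset.sum_congr rfl fun d _ => ?_).trans h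
      rw [norm_sub_rev]
    rw [Finset.sum_congr rfl this]
    simp
  rw [Finset.sum_congr rfl fun d _ => hconst _ (norm_node_le n d), Finset.sum_const,
    Finset.card_range, nsmul_eq_mul] at htot
  rw [hconst x hx, show (n : ℤ) - m = ((2 * n : ℕ) : ℤ) - (K : ℤ) by push_cast; omega,
    zpow_sub₀ hp, zpow_natCast, zpow_natCast, ← htot]
  push_cast
  field_simp

lemma IsPolC.mono_level {d : ℕ} {f : ℚ_[p] → L} {N N' : ℕ} (hN : N ≤ N')
    (h : (∀ z : ℚ_[p], (p : ℝ) ^ (N : ℤ) < ‖z‖ → f z = 0) ∧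
      ∀ a : ℚ_[p], ∃ P : Polynomial L, P.natDegree ≤ d ∧
        ∀ z : ℚ_[p], ‖z - a‖ ≤ (p : ℝ) ^ (-(N : ℤ)) → f z = Polynomial.eval (iotaL p L z) P) :
    (∀ z : ℚ_[p], (p : ℝ) ^ (N' : ℤ) < ‖z‖ → f z = 0) ∧
      ∀ a : ℚ_[p], ∃ P : Polynomial L, P.natDegree ≤ d ∧
        ∀ z : ℚ_[p], ‖z - a‖ ≤ (p : ℝ) ^ (-(N' : ℤ)) → f z = Polynomial.eval (iotaL p L z) P := by
  refine ⟨fun z hz => h.1 z (lt_of_le_of_lt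
    (zpow_le_zpow_right₀ one_lt_cast_prime.le (by omega)) hz), fun a => ?_⟩
  obtain ⟨P, hP, hf⟩ := h.2 a
  exact ⟨P, hP, fun z hz => hf z (hz.trans
    (zpow_le_zpow_right₀ one_lt_cast_prime.le (by omega)))⟩

lemma IsPolC.add {d : ℕ} {f g : ℚ_[p] → L} (hf : IsPolC p L d f) (hg : IsPolC p L d g) :
    IsPolC p L d (f + g) := by
  obtain ⟨N, hf⟩ := hf
  obtain ⟨N', hg⟩ := hg
  have hf := IsPolC.mono_level (le_max_left N N') hf
  have hg := IsPolC.mono_level (le_max_right N N') hg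
  refine ⟨max N N', fun z hz => by simp [hf.1 z hz, hg.1 z hz], fun a => ?_⟩
  obtain ⟨P, hP, hfP⟩ := hf.2 a
  obtain ⟨Q, hQ, hgQ⟩ := hg.2 a
  exact ⟨P + Q, (Polynomial.natDegree_add_le _ _).trans (max_le hP hQ),
    fun z hz => by simp [hfP z hz, hgQ z hz]⟩

lemma IsPolC.smul {d : ℕ} (c : L) {f : ℚ_[p] → L} (hf : IsPolC p L d f) :
    IsPolC p L d (c • f) := by
  obtain ⟨N, hf⟩ := hf
  refine ⟨N, fun z hz => by simp [hf.1 z hz], fun a => ?_⟩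
  obtain ⟨P, hP, hfP⟩ := hf.2 a
  exact ⟨c • P, (Polynomial.natDegree_smul_le _ _).trans hP, fun z hz => by simp [hfP z hz]⟩

lemma IsPolC.zero (d : ℕ) : IsPolC p L d 0 :=
  ⟨0, fun _ _ => rfl, fun _ => ⟨0, by simp, fun _ _ => by simp⟩⟩

lemma IsPolC.sum {d : ℕ} {ι : Type*} (S : Finset ι) (c : ι → L) (f : ι → ℚ_[p] → L)
    (hf : ∀ s ∈ S, IsPolC p L d (f s)) : IsPolC p L d (∑ s ∈ S, c s • f s) := by
  induction S using Finset.induction_on with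
  | empty => simpa using IsPolC.zero d
  | insert a S ha ih =>
    rw [Finset.sum_insert ha]
    exact ((hf a (Finset.mem_insert_self a S)).smul _).add
      (ih fun s hs => hf s (Finset.mem_insert_of_mem hs))

lemma PolCDual.map_sum {d : ℕ} (μ : PolCDual p L d) {ι : Type*} (S : Finset ι) (c : ι → L)
    (f : ι → ℚ_[p] → L) (hf : ∀ s ∈ S, IsPolC p L d (f s)) :
    μ.toFun (∑ s ∈ S, c s • f s) = ∑ s ∈ S, c s * μ.toFun (f s) := by
  induction S using Finset.induction_on with
  | empty =>
    have := μ.map_smul' 0 0 (IsPolC.zero d)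
    simpa using this
  | insert a S ha ih =>
    have hS : ∀ s ∈ S, IsPolC p L d (f s) := fun s hs => hf s (Finset.mem_insert_of_mem hs)
    have haf := hf a (Finset.mem_insert_self a S)
    rw [Finset.sum_insert ha, Finset.sum_insert ha,
      μ.map_add' _ _ (haf.smul _) (IsPolC.sum S c f hS), ih hS, μ.map_smul' _ _ haf]

/-- The function `z ↦ 1_{a + p^M ℤ_p}(z) z^j` on `ℚ_p`. -/
def ballMonomial (L : Type) [NontriviallyNormedField L] [NormedAlgebra ℚ_[p] L]
    (j : ℕ) (a : ℚ_[p]) (M : ℤ) : ℚ_[p] → L :=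
  fun z => if ‖z - a‖ ≤ (p : ℝ) ^ (-M) then (iotaL p L z) ^ j else 0

lemma exists_norm_le_zpow (a : ℚ_[p]) : ∃ N : ℕ, ‖a‖ ≤ (p : ℝ) ^ (N : ℤ) := by
  obtain ⟨N, hN⟩ := pow_unbounded_of_one_lt ‖a‖ (one_lt_cast_prime (p := p))
  exact ⟨N, by simpa using hN.le⟩

lemma isPolC_ballMonomial {d j : ℕ} (hj : j ≤ d) (a : ℚ_[p]) (M : ℤ) :
    IsPolC p L d (ballMonomial L j a M) := by
  obtain ⟨N₀, hN₀⟩ := exists_norm_le_zpow a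
  have hmono : ∀ {m n : ℤ}, m ≤ n → (p : ℝ) ^ m ≤ (p : ℝ) ^ n := fun h =>
    zpow_le_zpow_right₀ one_lt_cast_prime.le h
  refine ⟨max N₀ M.natAbs, fun z hz => if_neg fun h => hz.not_ge ?_, fun b => ?_⟩
  · have := norm_add_le_of_le (h.trans (hmono (show -M ≤ ((max N₀ M.natAbs : ℕ) : ℤ) by omega)))
      (hN₀.trans (hmono (show (N₀ : ℤ) ≤ ((max N₀ M.natAbs : ℕ) : ℤ) by omega)))
    simpa using this
  · have hiff : ∀ z : ℚ_[p], ‖z - b‖ ≤ (p : ℝ) ^ (-((max N₀ M.natAbs : ℕ) : ℤ)) →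
        (‖z - a‖ ≤ (p : ℝ) ^ (-M) ↔ ‖b - a‖ ≤ (p : ℝ) ^ (-M)) := fun z hz =>
      norm_le_iff_of_near (n := ((max N₀ M.natAbs : ℕ) : ℤ)) (by omega) (by simpa using hz)
    by_cases hb : ‖b - a‖ ≤ (p : ℝ) ^ (-M)
    · exact ⟨Polynomial.X ^ j, (Polynomial.natDegree_X_pow_le j).trans hj, fun z hz => by
        simp only [ballMonomial, hiff z hz, hb, if_true, Polynomial.eval_pow, Polynomial.eval_X]⟩
    · exact ⟨0, by simp, fun z hz => by
        simp only [ballMonomial, (hiff z hz), hb, if_false, Polynomial.eval_zero]⟩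

/-- The mass of `z^j` on the coset of level `n` of the node of index `c`. -/
def mass {d : ℕ} (μ : PolCDual p L d) (j n c : ℕ) : L :=
  μ.toFun (ballMonomial L j (node p n c) n)

/-- A function on `ℚ_p` is of level `n` if it is supported in `p^{-n}ℤ_p` and invariant
under `p^nℤ_p`. -/
def IsLevel {R : Type*} [Zero R] (n : ℕ) (g : ℚ_[p] → R) : Prop :=
  (∀ z : ℚ_[p], (p : ℝ) ^ (n : ℤ) < ‖z‖ → g z = 0) ∧
    ∀ z w : ℚ_[p], ‖z - w‖ ≤ (p : ℝ) ^ (-(n : ℤ)) → g z = g w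

lemma IsLevel.eq_sum {R : Type*} [AddCommMonoid R] {n : ℕ} {g : ℚ_[p] → R} (hg : IsLevel n g)
    (z : ℚ_[p]) : g z = ∑ c ∈ Finset.range (p ^ (2 * n)),
      if ‖z - node p n c‖ ≤ (p : ℝ) ^ (-(n : ℤ)) then g (node p n c) else 0 := by
  rw [sum_nodes_ball (two_mul_cast n) z hg.2]
  split_ifs with h
  · rfl
  · exact hg.1 z (not_le.1 h)

lemma PolCDual.toFun_eq_sum_mass {d : ℕ} (μ : PolCDual p L d) {n : ℕ} {S : Finset ℕ}
    (hS : ∀ j ∈ S, j ≤ d) {g : ℕ → ℚ_[p] → L} (hg : ∀ j ∈ S, IsLevel n (g j)) :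
    μ.toFun (fun z => ∑ j ∈ S, (iotaL p L z) ^ j * g j z)
      = ∑ j ∈ S, ∑ c ∈ Finset.range (p ^ (2 * n)), g j (node p n c) * mass μ j n c := by
  have h1 : (fun z => ∑ j ∈ S, (iotaL p L z) ^ j * g j z)
      = ∑ s ∈ S ×ˢ Finset.range (p ^ (2 * n)),
        g s.1 (node p n s.2) • ballMonomial L s.1 (node p n s.2) n := by
    funext z
    rw [Finset.sum_apply, Finset.sum_product]
    refine Finset.sum_congr rfl fun j hj => ?_
    conv_lhs => rw [(hg j hj).eq_sum z, Finset.mul_sum]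
    refine Finset.sum_congr rfl fun c _ => ?_
    simp only [ballMonomial, Pi.smul_apply, smul_eq_mul]
    split_ifs <;> ring
  rw [h1, μ.map_sum, Finset.sum_product]
  · rfl
  · exact fun s hs => isPolC_ballMonomial (hS _ (Finset.mem_product.1 hs).1) _ _

lemma isLevel_ball {R : Type*} [Zero R] (r : R) {n : ℕ} {M : ℤ} (hM1 : -(n : ℤ) ≤ M)
    (hM2 : M ≤ n) {a : ℚ_[p]} (ha : ‖a‖ ≤ (p : ℝ) ^ (n : ℤ)) :
    IsLevel n fun z : ℚ_[p] => if ‖z - a‖ ≤ (p : ℝ) ^ (-M) then r else 0 := by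
  refine ⟨fun z hz => if_neg fun h => hz.not_ge ?_, fun z w h => ?_⟩
  · simpa using norm_add_le_of_le
      (h.trans (zpow_le_zpow_right₀ one_lt_cast_prime.le (show -M ≤ (n : ℤ) by omega))) ha
  · simp only [norm_le_iff_of_near hM2 (show ‖(z - a) - (w - a)‖ ≤ _ by simpa using h)]

/-- The mass of a ball is the sum of the masses of the cosets of level `n` it contains. -/
lemma PolCDual.toFun_ballMonomial {d : ℕ} (μ : PolCDual p L d) {j n : ℕ} (hj : j ≤ d) {M : ℤ}
    (hM1 : -(n : ℤ) ≤ M) (hM2 : M ≤ n) {a : ℚ_[p]} (ha : ‖a‖ ≤ (p : ℝ) ^ (n : ℤ)) :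
    μ.toFun (ballMonomial L j a M) = ∑ c ∈ Finset.range (p ^ (2 * n)),
      if ‖node p n c - a‖ ≤ (p : ℝ) ^ (-M) then mass μ j n c else 0 := by
  have h := μ.toFun_eq_sum_mass (S := {j}) (n := n)
    (g := fun _ z => if ‖z - a‖ ≤ (p : ℝ) ^ (-M) then (1 : L) else 0) (by simpa using hj)
    (fun _ _ => isLevel_ball 1 hM1 hM2 ha)
  simp only [Finset.sum_singleton, mul_ite, mul_one, mul_zero, ite_mul, one_mul, zero_mul] at h
  exact h

lemma norm_le_zpow_neg_iff {u : ℚ_[p]} (hu : u ≠ 0) (m : ℤ) :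
    ‖u‖ ≤ (p : ℝ) ^ (-m) ↔ m ≤ u.valuation := by
  rw [Padic.norm_eq_zpow_neg_valuation hu, zpow_le_zpow_iff_right₀ one_lt_cast_prime, neg_le_neg_iff]

lemma valuation_eq_of_norm_eq {u w : ℚ_[p]} (hu : u ≠ 0) (h : ‖u‖ = ‖w‖) :
    u.valuation = w.valuation := by
  have hw : w ≠ 0 := fun hw => hu (by simpa [hw] using h)
  rw [Padic.norm_eq_zpow_neg_valuation hu, Padic.norm_eq_zpow_neg_valuation hw] at h
  simpa using zpow_right_injective₀ cast_prime_pos one_lt_cast_prime.ne' h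

lemma norm_eq_of_norm_sub_lt {u w : ℚ_[p]} (h : ‖u - w‖ < ‖u‖) : ‖u‖ = ‖w‖ := by
  by_contra hne
  have := Padic.add_eq_max_of_ne (q := u) (r := -w) (by rwa [norm_neg])
  rw [← sub_eq_add_neg, norm_neg] at this
  exact (h.trans_le (le_max_left _ _)).ne this

/-- The kernel of the operator `I` at level `n`, with `a = α/β`. -/
def kernel {E : Type*} [Field E] (a : E) (n : ℕ) (u : ℚ_[p]) : E :=
  if ‖u‖ ≤ (p : ℝ) ^ (-(n : ℤ)) then (1 - (p : E)⁻¹) * a ^ n / (1 - a)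
  else (a * p) ^ u.valuation * (p : E) ^ (-(n : ℤ))

lemma kernel_congr {E : Type*} [Field E] (a : E) {n : ℕ} {u w : ℚ_[p]}
    (h : ‖u - w‖ ≤ (p : ℝ) ^ (-(n : ℤ))) : kernel a n u = kernel a n w := by
  have hiff := norm_le_iff_of_near le_rfl h
  by_cases hu : ‖u‖ ≤ (p : ℝ) ^ (-(n : ℤ))
  · rw [kernel, kernel, if_pos hu, if_pos (hiff.1 hu)]
  · have hu0 : u ≠ 0 := by
      rintro rfl
      exact hu (by simp)
    rw [kernel, kernel, if_neg hu, if_neg (mt hiff.2 hu),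
      valuation_eq_of_norm_eq hu0 (norm_eq_of_norm_sub_lt (h.trans_lt (not_le.1 hu)))]

lemma map_kernel {E F : Type*} [Field E] [Field F] (σ : E →+* F) (a : E) (n : ℕ) (u : ℚ_[p]) :
    σ (kernel a n u) = kernel (σ a) n u := by
  unfold kernel
  split_ifs <;> simp

lemma iInt_eq_sum_kernel {L : Type} [NontriviallyNormedField L] (α β : L) {n : ℕ} {h : ℚ_[p] → L}
    (hh : ∀ z w : ℚ_[p], ‖z - w‖ ≤ (p : ℝ) ^ (-(n : ℤ)) → h z = h w) (z : ℚ_[p]) :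
    iInt p L α β h n z = ∑ c ∈ Finset.range (p ^ (2 * n)),
      h (node p n c) * kernel (α / β) n (z - node p n c) := by
  refine Finset.sum_congr rfl fun c _ => ?_
  rw [kernel, show α * (p : L) / β = α / β * p by ring]
  change (if ‖z - node p n c‖ ≤ _ then _ else h (node p n c) * _ ^ (z - node p n c).valuation * _)
    = _
  split_ifs with hc
  · rw [hh _ _ hc]
  · rw [mul_assoc]

lemma isLevel_iInt {L : Type} [NontriviallyNormedField L] (α β : L) {n : ℕ} {h : ℚ_[p] → L} (hh : IsLevel n h)
    (hsum : ∑ c ∈ Finset.range (p ^ (2 * n)), h (node p n c) = 0) :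
    IsLevel n (iInt p L α β h n) := by
  refine ⟨fun z hz => ?_, fun z w hzw => ?_⟩
  · have hz0 : z ≠ 0 := by
      rintro rfl
      exact hz.not_ge (by simp)
    have hk : ∀ c : ℕ, kernel (α / β) n (z - node p n c) = kernel (α / β) n z := by
      intro c
      have heq : ‖z‖ = ‖z - node p n c‖ :=
        norm_eq_of_norm_sub_lt (by simpa using (norm_node_le (p := p) n c).trans_lt hz)
      rw [kernel, kernel, ← heq, valuation_eq_of_norm_eq hz0 heq]
    rw [iInt_eq_sum_kernel α β hh.2]
    simp only [hk]
    rw [← Finset.sum_mul, hsum, zero_mul]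
  · rw [iInt_eq_sum_kernel α β hh.2, iInt_eq_sum_kernel α β hh.2]
    refine Finset.sum_congr rfl fun c _ => ?_
    rw [kernel_congr (α / β) (n := n) (u := z - node p n c) (w := w - node p n c)
      (by simpa using hzw)]

/-- The function `z ↦ 1_{p^{-N}ℤ_p}(z) ε(zy)`. -/
def truncChar {E : Type*} [Zero E] (ε : ℚ_[p] → E) (N : ℤ) (y z : ℚ_[p]) : E :=
  if ‖z‖ ≤ (p : ℝ) ^ N then ε (z * y) else 0

section Character

variable {E : Type*} [Field E] {ε : ℚ_[p] → E}

lemma truncChar_add (hε1 : ∀ x y : ℚ_[p], ε (x + y) = ε x * ε y) {N : ℤ} (y z : ℚ_[p])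
    {t : ℚ_[p]} (ht : ‖t‖ ≤ (p : ℝ) ^ N) :
    truncChar ε N y (z + t) = ε (t * y) * truncChar ε N y z := by
  have hiff : ‖z + t‖ ≤ (p : ℝ) ^ N ↔ ‖z‖ ≤ (p : ℝ) ^ N := by
    have := norm_le_iff_of_near (m := -N) (n := -N) le_rfl
      (show ‖(z + t) - z‖ ≤ (p : ℝ) ^ (-(-N)) by simpa using ht)
    simpa using this
  simp only [truncChar, hiff, add_mul, hε1]
  split_ifs <;> ring

lemma truncChar_congr (hε1 : ∀ x y : ℚ_[p], ε (x + y) = ε x * ε y)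
    (hε2 : ∀ x : ℚ_[p], ε x = 1 ↔ ‖x‖ ≤ 1) {N : ℤ} {y : ℚ_[p]} (hy : y ≠ 0)
    (hN : y.valuation < N) {m : ℤ} (hm : -y.valuation ≤ m) {z w : ℚ_[p]}
    (h : ‖z - w‖ ≤ (p : ℝ) ^ (-m)) : truncChar ε N y z = truncChar ε N y w := by
  have h1 : ‖z - w‖ ≤ (p : ℝ) ^ y.valuation :=
    h.trans (zpow_le_zpow_right₀ one_lt_cast_prime.le (by omega))
  have h2 : ε ((z - w) * y) = 1 := by
    rw [hε2, norm_mul, Padic.norm_eq_zpow_neg_valuation hy]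
    calc _ ≤ (p : ℝ) ^ y.valuation * (p : ℝ) ^ (-y.valuation) :=
          mul_le_mul_of_nonneg_right h1 (zpow_nonneg cast_prime_pos.le _)
      _ = 1 := by rw [← zpow_add₀ cast_prime_pos.ne']; simp
  have h3 := truncChar_add hε1 (N := N) y w (t := z - w)
    (h1.trans (zpow_le_zpow_right₀ one_lt_cast_prime.le hN.le))
  rwa [h2, one_mul, add_sub_cancel] at h3

/-- The sum of a truncated character over the nodes in a ball. -/
lemma sum_truncChar_ball [CharZero E] (hε1 : ∀ x y : ℚ_[p], ε (x + y) = ε x * ε y)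
    (hε2 : ∀ x : ℚ_[p], ε x = 1 ↔ ‖x‖ ≤ 1) {N : ℤ} {y : ℚ_[p]} (hy : y ≠ 0)
    (hN : y.valuation < N) {n : ℕ} (hNn : N ≤ n) (hyn : -(n : ℤ) ≤ y.valuation)
    {x : ℚ_[p]} (hx : ‖x‖ ≤ (p : ℝ) ^ (n : ℤ)) {m : ℤ} (hm1 : -(n : ℤ) ≤ m) (hm2 : m ≤ n) :
    (∑ c ∈ Finset.range (p ^ (2 * n)),
      if ‖x - node p n c‖ ≤ (p : ℝ) ^ (-m) then truncChar ε N y (node p n c) else 0)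
      = (if -y.valuation ≤ m then (p : E) ^ ((n : ℤ) - m) else 0) * truncChar ε N y x := by
  split_ifs with hm
  · rw [← card_nodes_ball n hm1 hm2 hx, Finset.sum_mul]
    refine Finset.sum_congr rfl fun c _ => ?_
    split_ifs with hc
    · rw [truncChar_congr hε1 hε2 hy hN hm hc, one_mul]
    · rw [zero_mul]
  · rw [zero_mul]
    have hp : (p : ℚ_[p]) ≠ 0 := by exact_mod_cast (Fact.out : p.Prime).ne_zero
    set t : ℚ_[p] := (p : ℚ_[p]) ^ (-(y.valuation + 1)) with ht
    have hmono : ∀ {m n : ℤ}, m ≤ n → (p : ℝ) ^ m ≤ (p : ℝ) ^ n := fun h =>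
      zpow_le_zpow_right₀ one_lt_cast_prime.le h
    have htn : ‖t‖ = (p : ℝ) ^ (y.valuation + 1) := by rw [ht, Padic.norm_p_zpow, neg_neg]
    have hty : ε (t * y) ≠ 1 := by
      rw [Ne, hε2, norm_mul, htn, Padic.norm_eq_zpow_neg_valuation hy,
        ← zpow_add₀ cast_prime_pos.ne']
      simpa using one_lt_cast_prime (p := p)
    have htm : ‖t‖ ≤ (p : ℝ) ^ (-m) := htn.trans_le (hmono (by omega))
    set F : ℚ_[p] → E := fun z =>
      if ‖x - z‖ ≤ (p : ℝ) ^ (-m) then truncChar ε N y z else 0 with hF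
    have hFt : ∀ z, F (z + t) = ε (t * y) * F z := by
      intro z
      have hiff : ‖x - (z + t)‖ ≤ (p : ℝ) ^ (-m) ↔ ‖x - z‖ ≤ (p : ℝ) ^ (-m) :=
        norm_le_iff_of_near le_rfl (by simpa using htm)
      simp only [hF, hiff, truncChar_add hε1 y z (htn.trans_le (hmono (show _ ≤ N by omega)))]
      split_ifs <;> ring
    have hFc : ∀ z w : ℚ_[p], ‖z - w‖ ≤ (p : ℝ) ^ (-(n : ℤ)) → F z = F w := by
      intro z w h
      have hiff : ‖x - z‖ ≤ (p : ℝ) ^ (-m) ↔ ‖x - w‖ ≤ (p : ℝ) ^ (-m) :=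
        norm_le_iff_of_near hm2 (by rwa [sub_sub_sub_cancel_left, norm_sub_rev])
      simp only [hF, hiff, truncChar_congr hε1 hε2 hy hN (show -y.valuation ≤ (n : ℤ) by omega) h]
    have hT := sum_nodes_translate n (t := t) (htn.trans_le (hmono (by omega))) hFc
    simp only [hFt] at hT
    rw [← Finset.mul_sum] at hT
    by_contra h0
    exact hty ((mul_eq_right₀ h0).1 hT)

end Character

section Character

variable {E : Type*} [Field E] {ε : ℚ_[p] → E}

/-- Decomposition of `u ↦ r ^ val(u)` into indicator functions of balls. -/
lemma zpow_valuation_eq_sum (r : E) {n : ℕ} {u : ℚ_[p]} (hu : ‖u‖ ≤ (p : ℝ) ^ (n : ℤ)) :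
    (if ‖u‖ ≤ (p : ℝ) ^ (-(n : ℤ)) then 0 else r ^ u.valuation)
      = ∑ i ∈ Finset.range (2 * n), r ^ ((i : ℤ) - n) *
        ((if ‖u‖ ≤ (p : ℝ) ^ (-((i : ℤ) - n)) then 1 else 0)
          - (if ‖u‖ ≤ (p : ℝ) ^ (-((i : ℤ) + 1 - n)) then 1 else 0)) := by
  split_ifs with h
  · refine (Finset.sum_eq_zero fun i hi => ?_).symm
    have hi := Finset.mem_range.1 hi
    have hmono : ∀ {m n : ℤ}, m ≤ n → (p : ℝ) ^ m ≤ (p : ℝ) ^ n := fun h =>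
      zpow_le_zpow_right₀ one_lt_cast_prime.le h
    rw [if_pos (h.trans (hmono (by omega))), if_pos (h.trans (hmono (by omega))), sub_self,
      mul_zero]
  · have hu0 : u ≠ 0 := by
      rintro rfl
      exact h (by simp)
    have h1 : -(n : ℤ) ≤ u.valuation := (norm_le_zpow_neg_iff hu0 _).1 (by simpa using hu)
    have h2 : ¬ (n : ℤ) ≤ u.valuation := fun h' => h ((norm_le_zpow_neg_iff hu0 _).2 h')
    simp only [norm_le_zpow_neg_iff hu0]
    rw [Finset.sum_eq_single_of_mem (u.valuation + n).toNat (Finset.mem_range.2 (by omega))]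
    · have h3 : (((u.valuation + n).toNat : ℕ) : ℤ) = u.valuation + n := by omega
      rw [h3, if_pos (by omega), if_neg (by omega)]
      simp
    · intro i _ hi
      by_cases h4 : (i : ℤ) - n ≤ u.valuation
      · rw [if_pos h4, if_pos (by omega), sub_self, mul_zero]
      · rw [if_neg h4, if_neg (by omega), sub_self, mul_zero]

/-- The eigenvalue of the kernel on a character of conductor given by `-v`. -/
lemma kernel_eigenvalue_eq [CharZero E] {a : E} (ha0 : a ≠ 0) (ha1 : a ≠ 1) {n : ℕ} {v : ℤ}
    (hv1 : -(n : ℤ) ≤ v) (hv2 : v < n) :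
    (1 - (p : E)⁻¹) * a ^ n / (1 - a) + (p : E) ^ (-(n : ℤ)) *
      ∑ i ∈ Finset.range (2 * n), (a * p) ^ ((i : ℤ) - n) *
        ((if -v ≤ (i : ℤ) - n then (p : E) ^ ((n : ℤ) - (i - n)) else 0)
          - (if -v ≤ (i : ℤ) + 1 - n then (p : E) ^ ((n : ℤ) - (i + 1 - n)) else 0))
      = (1 - 1 / (p * a)) / (1 - a) * a ^ (-v) := by
  have hp : (p : E) ≠ 0 := by exact_mod_cast (Fact.out : p.Prime).ne_zero
  have ha : (1 : E) - a ≠ 0 := sub_ne_zero.2 ha1.symm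
  have key : ∀ i : ℕ, (p : E) ^ (-(n : ℤ)) *
      ∑ i ∈ Finset.range i, (a * p) ^ ((i : ℤ) - n) *
        ((if -v ≤ (i : ℤ) - n then (p : E) ^ ((n : ℤ) - (i - n)) else 0)
          - (if -v ≤ (i : ℤ) + 1 - n then (p : E) ^ ((n : ℤ) - (i + 1 - n)) else 0))
      = if -v ≤ (i : ℤ) - n then
          (1 - (p : E)⁻¹) * (a ^ (-v) - a ^ ((i : ℤ) - n)) / (1 - a) - a ^ (-v) / (p * a)
        else 0 := by
    intro i
    induction i with
    | zero => rw [if_neg (by push_cast; omega)]; simp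
    | succ i ih =>
      rw [Finset.sum_range_succ, mul_add, ih]
      obtain ⟨m, hm⟩ : ∃ m : ℤ, (i : ℤ) = m + n := ⟨i - n, by ring⟩
      push_cast
      rw [hm, show m + n - (n : ℤ) = m by ring, show m + n + 1 - (n : ℤ) = m + 1 by ring]
      rcases lt_trichotomy (m + 1) (-v) with h | h | h
      · rw [if_neg (by omega), if_neg (by omega), if_neg (by omega), if_neg (by omega)]; simp
      · rw [if_neg (by omega), if_neg (by omega), if_pos (by omega), if_pos (by omega), ← h,
          show (n : ℤ) - (m + 1) = n + (-m) + (-1) by ring, zpow_add₀ hp, zpow_add₀ hp,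
          mul_zpow, zpow_add₀ ha0]
        simp only [zpow_neg, zpow_one, zpow_natCast]
        have h1 : (p : E) ^ m ≠ 0 := zpow_ne_zero _ hp
        field_simp
        ring
      · rw [if_pos (by omega), if_pos (by omega), if_pos (by omega), if_pos (by omega),
          show (n : ℤ) - (m + 1) = n + (-m) + (-1) by ring, show (n : ℤ) - m = n + (-m) by ring,
          zpow_add₀ hp ((n : ℤ) + -m), zpow_add₀ hp n (-m), mul_zpow, zpow_add₀ ha0]
        simp only [zpow_neg, zpow_one, zpow_natCast]
        have h1 : (p : E) ^ m ≠ 0 := zpow_ne_zero _ hp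
        have h2 : a ^ v ≠ 0 := zpow_ne_zero _ ha0
        field_simp
        ring
  rw [key, if_pos (by push_cast; omega), show ((2 * n : ℕ) : ℤ) - n = (n : ℤ) by push_cast; ring,
    zpow_natCast]
  simp only [zpow_neg]
  have h2 : a ^ v ≠ 0 := zpow_ne_zero _ ha0
  field_simp
  ring

/-- Truncated characters are eigenvectors of the kernel. -/
lemma sum_truncChar_kernel [CharZero E] (hε1 : ∀ x y : ℚ_[p], ε (x + y) = ε x * ε y)
    (hε2 : ∀ x : ℚ_[p], ε x = 1 ↔ ‖x‖ ≤ 1) {a : E} (ha0 : a ≠ 0) (ha1 : a ≠ 1)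
    {N : ℤ} {y : ℚ_[p]} (hy : y ≠ 0)
    (hN : y.valuation < N) {n : ℕ} (hNn : N ≤ n) (hyn : -(n : ℤ) ≤ y.valuation)
    {x : ℚ_[p]} (hx : ‖x‖ ≤ (p : ℝ) ^ (n : ℤ)) :
    ∑ c ∈ Finset.range (p ^ (2 * n)),
        truncChar ε N y (node p n c) * kernel a n (x - node p n c)
      = (1 - 1 / (p * a)) / (1 - a) * a ^ (-y.valuation) * truncChar ε N y x := by
  have hB := fun m hm1 hm2 =>
    sum_truncChar_ball hε1 hε2 hy hN hNn hyn hx (m := m) hm1 hm2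
  rw [← kernel_eigenvalue_eq (p := p) ha0 ha1 hyn (by omega : y.valuation < n)]
  set A : E := (1 - (p : E)⁻¹) * a ^ n / (1 - a) with hA
  have hterm : ∀ c : ℕ, truncChar ε N y (node p n c) * kernel a n (x - node p n c)
      = A * (if ‖x - node p n c‖ ≤ (p : ℝ) ^ (-(n : ℤ)) then truncChar ε N y (node p n c) else 0)
        + (p : E) ^ (-(n : ℤ)) * ∑ i ∈ Finset.range (2 * n), (a * p) ^ ((i : ℤ) - n) *
          ((if ‖x - node p n c‖ ≤ (p : ℝ) ^ (-((i : ℤ) - n)) then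
              truncChar ε N y (node p n c) else 0)
            - (if ‖x - node p n c‖ ≤ (p : ℝ) ^ (-((i : ℤ) + 1 - n)) then
              truncChar ε N y (node p n c) else 0)) := by
    intro c
    have hk : kernel a n (x - node p n c)
        = A * (if ‖x - node p n c‖ ≤ (p : ℝ) ^ (-(n : ℤ)) then 1 else 0)
          + (p : E) ^ (-(n : ℤ)) * (if ‖x - node p n c‖ ≤ (p : ℝ) ^ (-(n : ℤ)) then 0
            else (a * p) ^ (x - node p n c).valuation) := by
      rw [kernel]
      split_ifs <;> ring
    rw [hk, zpow_valuation_eq_sum _ (norm_sub_le_of_le hx (norm_node_le _ _)), mul_add,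
      mul_left_comm, mul_left_comm _ ((p : E) ^ _), Finset.mul_sum]
    congr 2
    · split_ifs <;> simp
    · refine Finset.sum_congr rfl fun i _ => ?_
      split_ifs <;> ring
  rw [Finset.sum_congr rfl fun c _ => hterm c, Finset.sum_add_distrib, ← Finset.mul_sum,
    ← Finset.mul_sum, Finset.sum_comm, hB n (by omega) le_rfl, if_pos (by omega), add_mul,
    sub_self, zpow_zero, one_mul, mul_assoc _ (Finset.sum _ _), Finset.sum_mul]
  congr 2
  refine Finset.sum_congr rfl fun i hi => ?_
  have hi := Finset.mem_range.1 hi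
  rw [← Finset.mul_sum, Finset.sum_sub_distrib, hB _ (by omega) (by omega),
    hB _ (by omega) (by omega)]
  ring

/-- Orthogonality of characters of `p^{-n}ℤ_p / p^nℤ_p`. -/
lemma sum_char_nodes (hε1 : ∀ x y : ℚ_[p], ε (x + y) = ε x * ε y)
    (hε2 : ∀ x : ℚ_[p], ε x = 1 ↔ ‖x‖ ≤ 1) {n : ℕ} {u : ℚ_[p]} (hu : ‖u‖ ≤ (p : ℝ) ^ (n : ℤ)) :
    ∑ b ∈ Finset.range (p ^ (2 * n)), ε (u * node p n b)
      = if ‖u‖ ≤ (p : ℝ) ^ (-(n : ℤ)) then (p : E) ^ (2 * n) else 0 := by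
  have hone : ∀ (m : ℤ) (z w : ℚ_[p]), ‖z‖ ≤ (p : ℝ) ^ m → ‖w‖ ≤ (p : ℝ) ^ (-m) →
      ε (z * w) = 1 := by
    intro m z w hz hw
    rw [hε2, norm_mul]
    calc _ ≤ (p : ℝ) ^ m * (p : ℝ) ^ (-m) :=
          mul_le_mul hz hw (norm_nonneg _) (zpow_nonneg cast_prime_pos.le _)
      _ = 1 := by rw [← zpow_add₀ cast_prime_pos.ne']; simp
  split_ifs with h
  · rw [Finset.sum_congr rfl fun b _ =>
      hone (-(n : ℤ)) u (node p n b) h (by simpa using norm_node_le n b)]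
    simp
  · have ht : ‖((p : ℚ_[p]) ^ (-(n : ℤ)))‖ = (p : ℝ) ^ (n : ℤ) := by
      rw [Padic.norm_p_zpow, neg_neg]
    have hut : ε (u * (p : ℚ_[p]) ^ (-(n : ℤ))) ≠ 1 := by
      rw [Ne, hε2, norm_mul, ht, not_le]
      calc (1 : ℝ) = (p : ℝ) ^ (-(n : ℤ)) * (p : ℝ) ^ (n : ℤ) := by
            rw [← zpow_add₀ cast_prime_pos.ne']; simp
        _ < _ := mul_lt_mul_of_pos_right (not_le.1 h) (zpow_pos cast_prime_pos _)
    have hT := sum_nodes_translate n ht.le (F := fun z => ε (u * z)) (by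
      intro z w hzw
      rw [show u * z = u * w + u * (z - w) by ring, hε1, hone n u (z - w) hu hzw, mul_one])
    simp only [mul_add, hε1] at hT
    rw [← Finset.sum_mul] at hT
    by_contra h0
    exact hut ((mul_eq_left₀ h0).1 hT)

/-- A function on the nodes orthogonal to all nontrivial characters is constant. -/
lemma eq_of_orthogonal [CharZero E] (hε1 : ∀ x y : ℚ_[p], ε (x + y) = ε x * ε y)
    (hε2 : ∀ x : ℚ_[p], ε x = 1 ↔ ‖x‖ ≤ 1) {n : ℕ} {T : ℕ → E}
    (hT : ∀ b ∈ Finset.range (p ^ (2 * n)), b ≠ 0 →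
      ∑ c ∈ Finset.range (p ^ (2 * n)), ε (node p n c * node p n b) * T c = 0)
    {c : ℕ} (hc : c ∈ Finset.range (p ^ (2 * n))) :
    (p : E) ^ (2 * n) * T c = ∑ d ∈ Finset.range (p ^ (2 * n)), T d := by
  have h1 : ∑ b ∈ Finset.range (p ^ (2 * n)), ∑ d ∈ Finset.range (p ^ (2 * n)),
      ε ((node p n d - node p n c) * node p n b) * T d = (p : E) ^ (2 * n) * T c := by
    rw [Finset.sum_comm, Finset.sum_eq_single_of_mem c hc]
    · rw [← Finset.sum_mul, sum_char_nodes hε1 hε2 (norm_sub_le_of_le (norm_node_le _ _)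
        (norm_node_le _ _)), if_pos (by simp)]
    · intro d hd hdc
      rw [← Finset.sum_mul, sum_char_nodes hε1 hε2 (norm_sub_le_of_le (norm_node_le _ _)
        (norm_node_le _ _)), if_neg, zero_mul]
      exact fun h => hdc (node_near_unique (two_mul_cast n) hd hc
        (x := node p n d) (by simp) h)
  rw [← h1, Finset.sum_eq_single_of_mem 0 (Finset.mem_range.2 (pow_pos (Fact.out : p.Prime).pos _))]
  · refine Finset.sum_congr rfl fun d _ => ?_
    have h0 : ε 0 = 1 := (hε2 0).2 (by simp)
    simp [node, h0]
  · intro b hb hb0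
    have : ∀ d, ε ((node p n d - node p n c) * node p n b) * T d
        = ε (-(node p n c * node p n b)) * (ε (node p n d * node p n b) * T d) := by
      intro d
      rw [show (node p n d - node p n c) * node p n b
        = -(node p n c * node p n b) + node p n d * node p n b by ring, hε1, mul_assoc]
    rw [Finset.sum_congr rfl fun d _ => this d, ← Finset.mul_sum, hT b hb hb0, mul_zero]

end Character

lemma charInt_eq_sum_mass {E : Type} [NontriviallyNormedField E] [NormedAlgebra ℚ_[p] E]
    (σ : L →+* E) {ε : ℚ_[p] → E} (hε1 : ∀ x y : ℚ_[p], ε (x + y) = ε x * ε y)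
    (hε2 : ∀ x : ℚ_[p], ε x = 1 ↔ ‖x‖ ≤ 1) {d : ℕ} (μ : PolCDual p L d) {j : ℕ} (hj : j ≤ d)
    {N : ℤ} {y : ℚ_[p]} (hy : y ≠ 0) (hN : y.valuation < N) {n : ℕ} (hNn : N ≤ n)
    (hyn : -(n : ℤ) ≤ y.valuation) :
    charInt p L E σ ε d μ j y N = ∑ c ∈ Finset.range (p ^ (2 * n)),
      truncChar ε N y (node p n c) * σ (mass μ j n c) := by
  set M : ℤ := max N (-y.valuation) with hM
  have h1 : charInt p L E σ ε d μ j y N = ∑ c ∈ Finset.range (p ^ (M + N).toNat),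
      ε (node p N c * y) * σ (μ.toFun (ballMonomial L j (node p N c) M)) := rfl
  have hg : ∀ z w : ℚ_[p], ‖z - w‖ ≤ (p : ℝ) ^ (-M) → ε (z * y) = ε (w * y) := by
    intro z w h
    have hone : ε ((z - w) * y) = 1 := by
      rw [hε2, norm_mul, Padic.norm_eq_zpow_neg_valuation hy]
      calc _ ≤ (p : ℝ) ^ (-M) * (p : ℝ) ^ (-y.valuation) :=
            mul_le_mul_of_nonneg_right h (zpow_nonneg cast_prime_pos.le _)
        _ ≤ 1 := by
            rw [← zpow_add₀ cast_prime_pos.ne']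
            exact zpow_le_one_of_nonpos₀ one_lt_cast_prime.le (by omega)
    rw [show z * y = w * y + (z - w) * y by ring, hε1, hone, mul_one]
  rw [h1]
  have h2 : ∀ c : ℕ, ε (node p N c * y) * σ (μ.toFun (ballMonomial L j (node p N c) M))
      = ∑ e ∈ Finset.range (p ^ (2 * n)),
        (if ‖node p n e - node p N c‖ ≤ (p : ℝ) ^ (-M) then ε (node p N c * y) else 0) *
          σ (mass μ j n e) := by
    intro c
    rw [μ.toFun_ballMonomial hj (show -(n : ℤ) ≤ M by omega) (by omega)
      ((norm_node_le N c).trans (zpow_le_zpow_right₀ one_lt_cast_prime.le hNn)), map_sum,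
      Finset.mul_sum]
    refine Finset.sum_congr rfl fun e _ => ?_
    split_ifs <;> simp
  rw [Finset.sum_congr rfl fun c _ => h2 c, Finset.sum_comm]
  refine Finset.sum_congr rfl fun e _ => ?_
  rw [← Finset.sum_mul, sum_nodes_ball (M := M) (N := N) (by omega) (node p n e) hg]
  rfl

/-- The discrepancy between `μβ` and `C` times the transpose of the kernel applied to `μα`, on
the coset of level `n` of the node of index `c`. -/
def defect {d : ℕ} (μα μβ : PolCDual p L d) (C a : L) (j n c : ℕ) : L :=
  mass μβ j n c - C * ∑ e ∈ Finset.range (p ^ (2 * n)),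
    kernel a n (node p n e - node p n c) * mass μα j n e

lemma sum_mul_defect {E : Type*} [Field E] (σ : L →+* E) {d : ℕ} (μα μβ : PolCDual p L d)
    (C a : L) (j n : ℕ) (g : ℕ → E) :
    ∑ c ∈ Finset.range (p ^ (2 * n)), g c * σ (defect μα μβ C a j n c)
      = (∑ c ∈ Finset.range (p ^ (2 * n)), g c * σ (mass μβ j n c))
        - σ C * ∑ e ∈ Finset.range (p ^ (2 * n)),
          (∑ c ∈ Finset.range (p ^ (2 * n)), g c * kernel (σ a) n (node p n e - node p n c)) *
            σ (mass μα j n e) := by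
  simp only [defect, map_sub, map_mul, map_sum, map_kernel, mul_sub, Finset.sum_sub_distrib,
    Finset.sum_mul, Finset.mul_sum]
  congr 1
  rw [Finset.sum_comm]
  refine Finset.sum_congr rfl fun e _ => Finset.sum_congr rfl fun c _ => ?_
  ring

/-- The defect pairs with a truncated character as the difference of the two character
integrals. -/
lemma sum_truncChar_mul_defect {E : Type} [NontriviallyNormedField E] [NormedAlgebra ℚ_[p] E]
    [CharZero E]
    (σ : L →+* E) {ε : ℚ_[p] → E} (hε1 : ∀ x y : ℚ_[p], ε (x + y) = ε x * ε y)
    (hε2 : ∀ x : ℚ_[p], ε x = 1 ↔ ‖x‖ ≤ 1) {d : ℕ} (μα μβ : PolCDual p L d) {a : L}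
    (ha0 : a ≠ 0) (ha1 : a ≠ 1) (hpa : 1 - 1 / (p * a) ≠ 0) {j : ℕ} (hj : j ≤ d)
    {N : ℤ} {y : ℚ_[p]} (hy : y ≠ 0) (hN : y.valuation < N) {n : ℕ} (hNn : N ≤ n)
    (hyn : -(n : ℤ) ≤ y.valuation) :
    ∑ c ∈ Finset.range (p ^ (2 * n)), truncChar ε N y (node p n c) *
        σ (defect μα μβ ((1 - a) / (1 - 1 / (p * a))) a j n c)
      = charInt p L E σ ε d μβ j y N - σ (a⁻¹ ^ y.valuation) * charInt p L E σ ε d μα j y N := by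
  have ha : 1 - a ≠ 0 := sub_ne_zero.2 ha1.symm
  have hσa0 : σ a ≠ 0 := (map_ne_zero σ).2 ha0
  have hσa1 : σ a ≠ 1 := fun h => ha1 (σ.injective (by rw [h, map_one]))
  rw [sum_mul_defect, charInt_eq_sum_mass σ hε1 hε2 μβ hj hy hN hNn hyn,
    charInt_eq_sum_mass σ hε1 hε2 μα hj hy hN hNn hyn]
  congr 1
  have hk : ∀ e : ℕ, ∑ c ∈ Finset.range (p ^ (2 * n)), truncChar ε N y (node p n c) *
      kernel (σ a) n (node p n e - node p n c)
      = σ ((1 - 1 / (p * a)) / (1 - a) * a⁻¹ ^ y.valuation) * truncChar ε N y (node p n e) := by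
    intro e
    rw [sum_truncChar_kernel hε1 hε2 hσa0 hσa1 hy hN hNn hyn (norm_node_le _ _)]
    simp
  simp only [hk, Finset.mul_sum]
  refine Finset.sum_congr rfl fun e _ => ?_
  rw [mul_assoc, ← mul_assoc (σ _) (σ _), ← map_mul]
  congr 2
  rw [← mul_assoc, div_mul_div_cancel₀ hpa, div_self ha, one_mul]

lemma toFun_sub_eq_sum_defect (α β C : L) {d : ℕ} (μα μβ : PolCDual p L d) {n : ℕ} {S : Finset ℕ}
    (hS : ∀ j ∈ S, j ≤ d) {h : ℕ → ℚ_[p] → L} (hh : ∀ j ∈ S, IsLevel n (h j))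
    (hsum : ∀ j ∈ S, ∑ c ∈ Finset.range (p ^ (2 * n)), h j (node p n c) = 0) :
    μβ.toFun (fun z => ∑ j ∈ S, (iotaL p L z) ^ j * h j z)
      - C * μα.toFun (fun z => ∑ j ∈ S, (iotaL p L z) ^ j * iInt p L α β (h j) n z)
      = ∑ j ∈ S, ∑ c ∈ Finset.range (p ^ (2 * n)),
        h j (node p n c) * defect μα μβ C (α / β) j n c := by
  rw [μβ.toFun_eq_sum_mass hS hh, μα.toFun_eq_sum_mass (g := fun j => iInt p L α β (h j) n) hS
    fun j hj => isLevel_iInt α β (hh j hj) (hsum j hj), Finset.mul_sum, ← Finset.sum_sub_distrib]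
  refine Finset.sum_congr rfl fun j hj => ?_
  have := sum_mul_defect (RingHom.id L) μα μβ C (α / β) j n fun c => h j (node p n c)
  simp only [RingHom.id_apply] at this
  rw [this]
  simp only [iInt_eq_sum_kernel α β (hh j hj).2]

lemma node_valuation_bounds {n b : ℕ} (hb : b ∈ Finset.range (p ^ (2 * n))) (hb0 : b ≠ 0) :
    node p n b ≠ 0 ∧ -(n : ℤ) ≤ (node p n b).valuation ∧ (node p n b).valuation < n := by
  have hfar : ¬ ‖node p n b‖ ≤ (p : ℝ) ^ (-(n : ℤ)) := fun h =>
    hb0 (node_near_unique (two_mul_cast n) hb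
      (Finset.mem_range.2 (pow_pos (Fact.out : p.Prime).pos _)) (x := node p n b) (by simp)
      (by simpa [node] using h))
  have h0 : node p n b ≠ 0 := fun h => hfar (by simp [h])
  exact ⟨h0, (norm_le_zpow_neg_iff h0 _).1 (by simpa using norm_node_le n b),
    not_le.1 fun h => hfar ((norm_le_zpow_neg_iff h0 _).2 h)⟩

lemma sum_ball_mul {R : Type*} [CommSemiring R] {n c : ℕ} (hc : c ∈ Finset.range (p ^ (2 * n)))
    (T : ℕ → R) : ∑ e ∈ Finset.range (p ^ (2 * n)),
      (if ‖node p n e - node p n c‖ ≤ (p : ℝ) ^ (-(n : ℤ)) then 1 else 0) * T e = T c := by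
  rw [Finset.sum_eq_single_of_mem c hc, if_pos (by simp), one_mul]
  intro e he hne
  rw [if_neg fun h => hne (node_near_unique (two_mul_cast n) he hc (x := node p n e) (by simp) h),
    zero_mul]

end Helpers

/-- Let `μ_α, μ_β` be linear functionals on `Pol^{k-2}(ℚ_p, L)`.  The following
are equivalent: (i) for all `0 ≤ j ≤ k-2`, `y ∈ ℚ_p^×` and `N > val(y)`,
`∫_{p^{-N}ℤ_p} z^j ε(zy) dμ_β = (β/α)^{val y} ∫_{p^{-N}ℤ_p} z^j ε(zy) dμ_α`;
(ii) for every `f = ∑_j z^j h_j ∈ Pol^{k-2}(ℚ_p, L)` with each `h_j` locally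
constant, compactly supported and of total integral `0`,
`μ_β(f) = ((1 - α/β)/(1 - β/(pα))) μ_α(I(f))` where
`I(f)(z) = ∑_j z^j ∫ (pα/β)^{val(z-x)} h_j(x) dx`. -/
theorem statement16 (p : ℕ) [Fact p.Prime] (L : Type) [NontriviallyNormedField L]
    [NormedAlgebra ℚ_[p] L] [FiniteDimensional ℚ_[p] L] [IsUltrametricDist L]
    (E : Type) [NontriviallyNormedField E] [NormedAlgebra ℚ_[p] E]
    (σ : L →+* E) (hσ : ∀ x : ℚ_[p], σ (algebraMap ℚ_[p] L x) = algebraMap ℚ_[p] E x)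
    (ε : ℚ_[p] → E) (hε1 : ∀ x y : ℚ_[p], ε (x + y) = ε x * ε y)
    (hε2 : ∀ x : ℚ_[p], ε x = 1 ↔ ‖x‖ ≤ 1)
    (k : ℕ) (α β : L)
    (hk : 2 ≤ k) (hαβ : α ≠ β) (hα : 0 < valL p L α) (hβ : 0 < valL p L β)
    (hsum : valL p L α + valL p L β = (k : ℝ) - 1) (hge : valL p L β ≤ valL p L α)
    (μα μβ : PolCDual p L (k - 2)) :
    (∀ j : ℕ, j ≤ k - 2 → ∀ y : ℚ_[p], y ≠ 0 → ∀ N : ℤ, y.valuation < N →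
        charInt p L E σ ε (k - 2) μβ j y N
          = σ ((β / α) ^ y.valuation) * charInt p L E σ ε (k - 2) μα j y N) ↔
    (∀ (hh : ℕ → ℚ_[p] → L) (N : ℕ),
        (∀ j : ℕ, j ≤ k - 2 →
          (∀ z : ℚ_[p], (p : ℝ) ^ (N : ℤ) < ‖z‖ → hh j z = 0) ∧
          (∀ z w : ℚ_[p], ‖z - w‖ ≤ (p : ℝ) ^ (-(N : ℤ)) → hh j z = hh j w)) →
        (∀ j : ℕ, j ≤ k - 2 →
          ∑ c ∈ Finset.range (p ^ (2 * N)), hh j ((p : ℚ_[p]) ^ (-(N : ℤ)) * (c : ℚ_[p])) = 0) →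
        μβ.toFun (fun z => ∑ j ∈ Finset.range (k - 1), (iotaL p L z) ^ j * hh j z)
          = ((1 - α / β) / (1 - β / ((p : L) * α))) *
              μα.toFun (fun z => ∑ j ∈ Finset.range (k - 1),
                (iotaL p L z) ^ j * iInt p L α β (hh j) N z)) := by
  have hne : ∀ {x : L}, 0 < valL p L x → x ≠ 0 := by
    rintro x hx rfl
    simp [valL] at hx
  have hα0 := hne hα
  have hβ0 := hne hβ
  have : CharZero L := charZero_of_injective_algebraMap (algebraMap ℚ_[p] L).injective
  have : CharZero E := charZero_of_injective_algebraMap (algebraMap ℚ_[p] E).injective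
  have hpL : (p : L) ≠ 0 := by exact_mod_cast (Fact.out : p.Prime).ne_zero
  set a : L := α / β with ha
  have ha0 : a ≠ 0 := div_ne_zero hα0 hβ0
  have ha1 : a ≠ 1 := fun h => hαβ ((div_eq_one_iff_eq hβ0).1 h)
  have hinv : β / α = a⁻¹ := by rw [ha, inv_div]
  have hC : β / ((p : L) * α) = 1 / (p * a) := by rw [ha]; field_simp
  have hpa : 1 - 1 / ((p : L) * a) ≠ 0 := by
    intro h
    have h1 : (p : L) * α = β := by
      rw [← hC, sub_eq_zero, eq_comm, div_eq_one_iff_eq (mul_ne_zero hpL hα0)] at h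
      exact h.symm
    have hpn : ‖(p : L)‖ = (p : ℝ)⁻¹ := by
      rw [← Padic.norm_p (p := p), ← norm_algebraMap' L (p : ℚ_[p]), map_natCast]
    have h2 : valL p L β = 1 + valL p L α := by
      rw [valL, valL, ← h1, norm_mul, hpn,
        Real.logb_mul (inv_ne_zero cast_prime_pos.ne') (norm_ne_zero_iff.2 hα0), Real.logb_inv,
        Real.logb_self_eq_one one_lt_cast_prime]
      ring
    linarith
  rw [hC, hinv]
  set C : L := (1 - a) / (1 - 1 / (p * a)) with hCdef
  have hle : ∀ j ∈ Finset.range (k - 1), j ≤ k - 2 := fun j hj => by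
    have := Finset.mem_range.1 hj
    omega
  constructor
  · intro hi hh n hlev hsum0
    rw [← sub_eq_zero, toFun_sub_eq_sum_defect α β C μα μβ hle (fun j hj => hlev j (hle j hj))
      (fun j hj => hsum0 j (hle j hj))]
    refine Finset.sum_eq_zero fun j hj => ?_
    have horth : ∀ b ∈ Finset.range (p ^ (2 * n)), b ≠ 0 →
        ∑ c ∈ Finset.range (p ^ (2 * n)),
          ε (node p n c * node p n b) * σ (defect μα μβ C a j n c) = 0 := by
      intro b hb hb0
      obtain ⟨hy, hv1, hv2⟩ := node_valuation_bounds hb hb0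
      have h := sum_truncChar_mul_defect σ hε1 hε2 μα μβ ha0 ha1 hpa (hle j hj) hy hv2 le_rfl hv1
      rw [hi j (hle j hj) _ hy _ hv2, sub_self] at h
      rw [← h]
      refine Finset.sum_congr rfl fun c _ => ?_
      rw [truncChar, if_pos (norm_node_le _ _)]
    have hconst : ∀ c ∈ Finset.range (p ^ (2 * n)), (p : L) ^ (2 * n) * defect μα μβ C a j n c
        = ∑ e ∈ Finset.range (p ^ (2 * n)), defect μα μβ C a j n e := by
      intro c hc
      apply σ.injective
      simpa using eq_of_orthogonal hε1 hε2 horth hc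
    refine (mul_eq_zero.1 ?_).resolve_left (pow_ne_zero (2 * n) hpL)
    rw [Finset.mul_sum, Finset.sum_congr rfl fun c hc => by
      rw [mul_left_comm, hconst c hc], ← Finset.sum_mul]
    exact mul_eq_zero_of_left (hsum0 j (hle j hj)) _
  · intro hii j hj y hy N hN
    set n : ℕ := max N.natAbs y.valuation.natAbs with hn
    have hNn : N ≤ n := by omega
    have hyn : -(n : ℤ) ≤ y.valuation := by omega
    rw [← sub_eq_zero, ← sum_truncChar_mul_defect σ hε1 hε2 μα μβ ha0 ha1 hpa hj hy hN hNn hyn]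
    have h0mem : 0 ∈ Finset.range (p ^ (2 * n)) :=
      Finset.mem_range.2 (pow_pos (Fact.out : p.Prime).pos _)
    have hconst : ∀ c ∈ Finset.range (p ^ (2 * n)),
        defect μα μβ C a j n c = defect μα μβ C a j n 0 := by
      intro c hc
      set g : ℚ_[p] → L := fun z =>
        (if ‖z - node p n c‖ ≤ (p : ℝ) ^ (-(n : ℤ)) then 1 else 0)
          - (if ‖z - node p n 0‖ ≤ (p : ℝ) ^ (-(n : ℤ)) then 1 else 0) with hg
      have hgT : ∀ T : ℕ → L, ∑ e ∈ Finset.range (p ^ (2 * n)), g (node p n e) * T e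
          = T c - T 0 := by
        intro T
        simp only [hg, sub_mul, Finset.sum_sub_distrib]
        rw [sum_ball_mul hc, sum_ball_mul h0mem]
      have hglev : IsLevel n g := by
        have h1 := isLevel_ball (1 : L) (M := n) (by omega) le_rfl (norm_node_le (p := p) n c)
        have h2 := isLevel_ball (1 : L) (M := n) (by omega) le_rfl (norm_node_le (p := p) n 0)
        exact ⟨fun z hz => by simp only [hg, h1.1 z hz, h2.1 z hz, sub_self],
          fun z w h => by simp only [hg, h1.2 z w h, h2.2 z w h]⟩
      set hh : ℕ → ℚ_[p] → L := fun i => if i = j then g else 0 with hhdef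
      have hlev : ∀ i : ℕ, IsLevel n (hh i) := by
        intro i
        by_cases h : i = j
        · simpa only [hhdef, h, if_true] using hglev
        · simp only [hhdef, h, if_false]
          exact ⟨fun _ _ => rfl, fun _ _ _ => rfl⟩
      have hzero : ∀ i : ℕ, ∑ e ∈ Finset.range (p ^ (2 * n)), hh i (node p n e) = 0 := by
        intro i
        by_cases h : i = j
        · simpa only [hhdef, h, if_true, mul_one, sub_self] using hgT fun _ => 1
        · simp [hhdef, h]
      have h := hii hh n (fun i _ => hlev i) (fun i _ => hzero i)
      rw [← sub_eq_zero, toFun_sub_eq_sum_defect α β C μα μβ hle (fun i _ => hlev i)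
        (fun i _ => hzero i), Finset.sum_eq_single_of_mem j (Finset.mem_range.2 (by omega))] at h
      · simp only [hhdef, if_true] at h
        rw [hgT] at h
        exact sub_eq_zero.1 h
      · intro i _ hij
        simp [hhdef, hij]
    rw [Finset.sum_congr rfl fun c hc => by rw [hconst c hc], ← Finset.sum_mul]
    have hz := sum_truncChar_ball hε1 hε2 hy hN hNn hyn (x := 0)
      (by simp) (m := -(n : ℤ)) le_rfl (by omega)
    rw [if_neg (by omega), zero_mul] at hz
    refine mul_eq_zero_of_left (Eq.trans (Finset.sum_congr rfl fun c _ => ?_) hz) _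
    rw [if_pos (by simpa using norm_node_le n c)]

end Paper

end
end

section
/- Let μ_α and μ_β be linear functionals on Pol^{k−2}(ℚ_p, L), identified with the space of compactly supported elements of both π(α) and π(β), and suppose that μ_β(f) = ((1 − α/β)/(1 − β/(pα))) · μ_α(I(f)) holds for every compactly supported f ∈ π(β) such that I(f) is also compactly supported. Then there exists a unique pair of linear functionals μ̃_β on π(β) and μ̃_α on π(α), extending μ_β and μ_α respectively, such that μ̃_β(f) = ((1 − α/β)/(1 − β/(pα))) · μ̃_α(I(f)) for every f ∈ π(β). -/
open Filter Topology Classical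

noncomputable section

namespace Paper

variable (p : ℕ) [Fact p.Prime]
variable (L : Type) [NontriviallyNormedField L] [NormedAlgebra ℚ_[p] L]

/-- The function `z ↦ z^j 1_{ℤ_p}(z)`. -/
noncomputable def genjFun (j : ℕ) : ℚ_[p] → L := fun z =>
  if ‖z‖ ≤ 1 then (iotaL p L z) ^ j else 0

/-- The explicit image `I(z^j 1_{ℤ_p})` of `z^j 1_{ℤ_p}` under the intertwining
operator `I : π(β) → π(α)`. -/
noncomputable def genjImageFun (k : ℕ) (α β : L) (j : ℕ) : ℚ_[p] → L := fun z =>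
  if ‖z‖ ≤ 1 then ((1 - (p : L)⁻¹) / (1 - α / β)) * (iotaL p L z) ^ j
  else (iotaL p L z) ^ j * (α * (p : L) / β) ^ z.valuation

/-- `Iop` is the standard intertwining operator `I : π(β) → π(α)`: it is
`L`-linear, `GL₂(ℚ_p)`-equivariant, and takes the prescribed values on the
generators `z^j 1_{ℤ_p}`. -/
def IopOk (k : ℕ) (α β : L) (Iop : (ℚ_[p] → L) → (ℚ_[p] → L)) : Prop :=
  (∀ f ∈ piRep p L k β α, Iop f ∈ piRep p L k α β) ∧
  (∀ f ∈ piRep p L k β α, ∀ g ∈ piRep p L k β α, Iop (f + g) = Iop f + Iop g) ∧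
  (∀ c : L, ∀ f ∈ piRep p L k β α, Iop (c • f) = c • Iop f) ∧
  (∀ m : Matrix (Fin 2) (Fin 2) ℚ_[p], det2 p m ≠ 0 → ∀ f ∈ piRep p L k β α,
    Iop (gAct p L k β α m f) = gAct p L k α β m (Iop f)) ∧
  (∀ j : ℕ, j ≤ k - 2 → Iop (genjFun p L j) = genjImageFun p L k α β j)


section Extension

variable {p L}

/-- Locally constant functions in the metric sense of `LocConst` are exactly those that
are eventually constant near every point. -/
lemma locConst_iff_eventually {h : ℚ_[p] → L} :
    LocConst p L h ↔ ∀ x, ∀ᶠ y in 𝓝 x, h y = h x := by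
  have hp : (1 : ℝ) < p := by exact_mod_cast (Fact.out : p.Prime).one_lt
  refine forall_congr' fun x => ⟨?_, ?_⟩
  · rintro ⟨n, hn⟩
    have hpos : (0 : ℝ) < (p : ℝ) ^ (-(n : ℤ)) := by positivity
    filter_upwards [Metric.closedBall_mem_nhds x hpos] with y hy
    exact hn y (by simpa [dist_eq_norm] using hy)
  · intro hx
    obtain ⟨ε, hε, hball⟩ := Metric.eventually_nhds_iff.1 hx
    obtain ⟨n, hn⟩ := exists_pow_lt_of_lt_one hε (inv_lt_one_of_one_lt₀ hp)
    refine ⟨n, fun y hy => hball ?_⟩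
    rw [dist_eq_norm]
    refine hy.trans_lt ?_
    simpa [zpow_neg, inv_pow] using hn

lemma Padic.valuation_eq_of_norm_eq {x y : ℚ_[p]} (hx : x ≠ 0) (h : ‖x‖ = ‖y‖) :
    x.valuation = y.valuation := by
  have hp : (1 : ℝ) < p := by exact_mod_cast (Fact.out : p.Prime).one_lt
  have hy : y ≠ 0 := by
    rw [← norm_ne_zero_iff, ← h]
    exact norm_ne_zero_iff.2 hx
  rw [Padic.norm_eq_zpow_neg_valuation hx, Padic.norm_eq_zpow_neg_valuation hy] at h
  have := zpow_right_injective₀ (by linarith) hp.ne' h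
  simpa using this

lemma Padic.norm_eq_of_norm_sub_le {x y : ℚ_[p]} {r : ℝ} (h : ‖y - x‖ ≤ r) (hx : r < ‖x‖) :
    ‖y‖ = ‖x‖ :=
  Padic.norm_eq_of_norm_sub_lt_right (h.trans_lt hx)

lemma Padic.norm_sub_le_trans {x y z : ℚ_[p]} {r : ℝ} (h₁ : ‖x - y‖ ≤ r) (h₂ : ‖y - z‖ ≤ r) :
    ‖x - z‖ ≤ r := by
  have h := Padic.nonarchimedean (x - y) (y - z)
  rw [sub_add_sub_cancel] at h
  exact h.trans (max_le h₁ h₂)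

lemma zpow_neg_natCast_le_one (n : ℕ) : (p : ℝ) ^ (-(n : ℤ)) ≤ 1 :=
  zpow_le_one_of_nonpos₀ (by exact_mod_cast (Fact.out : p.Prime).one_le) (by simp)

lemma one_le_zpow_natCast (n : ℕ) : (1 : ℝ) ≤ (p : ℝ) ^ (n : ℤ) :=
  one_le_zpow₀ (by exact_mod_cast (Fact.out : p.Prime).one_le) (by simp)

lemma zpow_neg_natCast_anti {m n : ℕ} (h : m ≤ n) :
    (p : ℝ) ^ (-(n : ℤ)) ≤ (p : ℝ) ^ (-(m : ℤ)) :=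
  zpow_le_zpow_right₀ (by exact_mod_cast (Fact.out : p.Prime).one_le) (by omega)

lemma zpow_natCast_mono {m n : ℕ} (h : m ≤ n) : (p : ℝ) ^ (m : ℤ) ≤ (p : ℝ) ^ (n : ℤ) :=
  zpow_le_zpow_right₀ (by exact_mod_cast (Fact.out : p.Prime).one_le) (by omega)

/-- A locally constant function supported in a ball is uniformly locally constant. -/
lemma LocConst.exists_uniform {h : ℚ_[p] → L} (hh : LocConst p L h) {N : ℕ}
    (hN : ∀ z : ℚ_[p], (p : ℝ) ^ (N : ℤ) < ‖z‖ → h z = 0) :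
    ∃ n : ℕ, ∀ a z : ℚ_[p], ‖z - a‖ ≤ (p : ℝ) ^ (-(n : ℤ)) → h z = h a := by
  have hp : (0 : ℝ) < p := by exact_mod_cast (Fact.out : p.Prime).pos
  choose n hn using hh
  obtain ⟨t, -, ht⟩ := (isCompact_closedBall (0 : ℚ_[p]) ((p : ℝ) ^ (N : ℤ))).elim_nhds_subcover
    (fun x => Metric.closedBall x ((p : ℝ) ^ (-(n x : ℤ))))
    (fun x _ => Metric.closedBall_mem_nhds x (by positivity))
  refine ⟨t.sup n, fun a z hz => ?_⟩
  rcases le_or_gt ‖a‖ ((p : ℝ) ^ (N : ℤ)) with ha | ha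
  · have := ht (show a ∈ Metric.closedBall 0 _ by simpa using ha)
    simp only [Set.mem_iUnion, Metric.mem_closedBall, dist_eq_norm] at this
    obtain ⟨x, hxt, hax⟩ := this
    have hzx := Padic.norm_sub_le_trans
      (hz.trans (zpow_neg_natCast_anti (Finset.le_sup hxt))) hax
    rw [hn x z hzx, hn x a hax]
  · have hza : ‖z‖ = ‖a‖ := Padic.norm_eq_of_norm_sub_le hz
      (((zpow_neg_natCast_le_one _).trans (one_le_zpow_natCast _)).trans_lt ha)
    rw [hN a ha, hN z (hza ▸ ha)]

/-- The space `Pol^d(ℚ_p, L)` as a submodule of the functions `ℚ_p → L`. -/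
def polC (p : ℕ) [Fact p.Prime] (L : Type) [NontriviallyNormedField L]
    [NormedAlgebra ℚ_[p] L] (d : ℕ) : Submodule L (ℚ_[p] → L) where
  carrier := {f | IsPolC p L d f}
  zero_mem' := ⟨0, fun _ _ => rfl, fun _ => ⟨0, by simp, by simp⟩⟩
  add_mem' := by
    rintro f g ⟨M, hM, hfM⟩ ⟨N, hN, hgN⟩
    refine ⟨max M N, fun z hz => ?_, fun a => ?_⟩
    · simp [hM z ((zpow_natCast_mono (le_max_left M N)).trans_lt hz),
        hN z ((zpow_natCast_mono (le_max_right M N)).trans_lt hz)]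
    · obtain ⟨P, hP, hfP⟩ := hfM a
      obtain ⟨Q, hQ, hgQ⟩ := hgN a
      refine ⟨P + Q, Polynomial.natDegree_add_le_of_degree_le hP hQ, fun z hz => ?_⟩
      simp [hfP z (hz.trans (zpow_neg_natCast_anti (le_max_left M N))),
        hgQ z (hz.trans (zpow_neg_natCast_anti (le_max_right M N)))]
  smul_mem' := by
    rintro c f ⟨N, hN, hfN⟩
    refine ⟨N, fun z hz => by simp [hN z hz], fun a => ?_⟩
    obtain ⟨P, hP, hfP⟩ := hfN a
    exact ⟨c • P, (Polynomial.natDegree_smul_le c P).trans hP, fun z hz => by simp [hfP z hz]⟩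

/-- The product of a polynomial and a compactly supported locally constant function is
locally polynomial with compact support. -/
lemma isPolC_eval_mul {d : ℕ} {P : Polynomial L} (hP : P.natDegree ≤ d) {h : ℚ_[p] → L}
    (hh : LocConst p L h) {N : ℕ} (hN : ∀ z : ℚ_[p], (p : ℝ) ^ (N : ℤ) < ‖z‖ → h z = 0) :
    IsPolC p L d (fun z => Polynomial.eval (iotaL p L z) P * h z) := by
  obtain ⟨n, hn⟩ := hh.exists_uniform hN
  refine ⟨max N n, fun z hz => ?_, fun a => ⟨h a • P, ?_, fun z hz => ?_⟩⟩
  · simp [hN z ((zpow_natCast_mono (le_max_left N n)).trans_lt hz)]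
  · exact (Polynomial.natDegree_smul_le _ P).trans hP
  · simp [hn a z (hz.trans (zpow_neg_natCast_anti (le_max_right N n))), mul_comm]

lemma isPolC_genjFun {d j : ℕ} (hj : j ≤ d) : IsPolC p L d (genjFun p L j) := by
  have hball : ∀ a z : ℚ_[p], ‖z - a‖ ≤ 1 → (‖z‖ ≤ 1 ↔ ‖a‖ ≤ 1) := by
    intro a z hz
    rcases le_or_gt ‖a‖ 1 with ha | ha
    · have := Padic.norm_sub_le_trans (z := 0) hz (by simpa using ha)
      simp_all
    · rw [Padic.norm_eq_of_norm_sub_le hz ha]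
  refine ⟨0, fun z hz => ?_, fun a => ⟨if ‖a‖ ≤ 1 then Polynomial.X ^ j else 0, ?_, ?_⟩⟩
  · simp only [Nat.cast_zero, zpow_zero] at hz
    simp [genjFun, hz.not_ge]
  · split_ifs
    · simpa using hj
    · simp
  · intro z hz
    simp only [Nat.cast_zero, neg_zero, zpow_zero] at hz
    simp only [genjFun, hball a z hz]
    split_ifs <;> simp

/-- A locally constant function with compact support satisfies `IndCond`. -/
lemma LocConst.indCond (α β : L) {h : ℚ_[p] → L} (hh : LocConst p L h) {N : ℕ}
    (hN : ∀ z : ℚ_[p], (p : ℝ) ^ (N : ℤ) < ‖z‖ → h z = 0) : IndCond p L α β h := by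
  have hp : (0 : ℝ) < p := by exact_mod_cast (Fact.out : p.Prime).pos
  refine ⟨hh, fun z => if z = 0 then 0 else (α * (p : L) / β) ^ z.valuation * h z⁻¹, ?_,
    fun z hz => if_neg hz⟩
  rw [locConst_iff_eventually] at hh ⊢
  intro x
  rcases eq_or_ne x 0 with rfl | hx
  · have hpos : (0 : ℝ) < ((p : ℝ) ^ (N : ℤ))⁻¹ := by positivity
    filter_upwards [Metric.ball_mem_nhds 0 hpos] with y hy
    rcases eq_or_ne y 0 with rfl | hy0
    · rfl
    · rw [if_neg hy0, if_pos rfl, hN, mul_zero]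
      rw [mem_ball_zero_iff] at hy
      rw [norm_inv]
      exact (lt_inv_comm₀ (norm_pos_iff.2 hy0) (by positivity)).1 hy
  · filter_upwards [Metric.ball_mem_nhds x (norm_pos_iff.2 hx), eventually_ne_nhds hx,
      (continuousAt_inv₀ hx).eventually (hh x⁻¹)] with y hy hy0 hinv
    rw [Metric.mem_ball, dist_eq_norm] at hy
    rw [if_neg hy0, if_neg hx, hinv,
      Padic.valuation_eq_of_norm_eq hy0 (Padic.norm_eq_of_norm_sub_lt_right hy)]

/-- A polynomial is determined by its values on a ball of `ℚ_p`. -/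
lemma polynomial_eq_of_eval_eq_on_ball {P Q : Polynomial L} {a : ℚ_[p]} {r : ℝ} (hr : 0 < r)
    (h : ∀ z : ℚ_[p], ‖z - a‖ ≤ r →
      Polynomial.eval (iotaL p L z) P = Polynomial.eval (iotaL p L z) Q) : P = Q := by
  refine Polynomial.eq_of_infinite_eval_eq P Q ?_
  have hinf := (infinite_of_mem_nhds a (Metric.closedBall_mem_nhds a hr)).image
    ((algebraMap ℚ_[p] L).injective.injOn)
  refine hinf.mono ?_
  rintro _ ⟨z, hz, rfl⟩
  exact h z (by simpa [dist_eq_norm] using hz)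

/-- Compactly supported locally polynomial functions belong to `π(α)`. -/
lemma IsPolC.mem_piRep {k : ℕ} (α β : L) {f : ℚ_[p] → L} (hf : IsPolC p L (k - 2) f) :
    f ∈ piRep p L k α β := by
  have hp : (0 : ℝ) < p := by exact_mod_cast (Fact.out : p.Prime).pos
  obtain ⟨N, hN, hloc⟩ := hf
  choose P hP hfP using hloc
  have hpos : (0 : ℝ) < (p : ℝ) ^ (-(N : ℤ)) := by positivity
  have hconst : ∀ a b : ℚ_[p], ‖b - a‖ ≤ (p : ℝ) ^ (-(N : ℤ)) → P b = P a := fun a b hab =>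
    polynomial_eq_of_eval_eq_on_ball (a := b) hpos fun z hz => by
      rw [← hfP b z hz, hfP a z (Padic.norm_sub_le_trans hz hab)]
  have hzero : ∀ a : ℚ_[p], (p : ℝ) ^ (N : ℤ) < ‖a‖ → P a = 0 := fun a ha =>
    polynomial_eq_of_eval_eq_on_ball (a := a) hpos fun z hz => by
      have hza : ‖z‖ = ‖a‖ := Padic.norm_eq_of_norm_sub_le hz
        (((zpow_neg_natCast_le_one _).trans (one_le_zpow_natCast _)).trans_lt ha)
      rw [← hfP a z hz, hN z (hza ▸ ha), Polynomial.eval_zero]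
  have hsum : f = ∑ j ∈ Finset.range (k - 2 + 1),
      fun z => Polynomial.eval (iotaL p L z) (Polynomial.X ^ j) * (P z).coeff j := by
    funext z
    rw [hfP z z (by simp),
      Polynomial.eval_eq_sum_range' (Nat.lt_succ_of_le (hP z)), Finset.sum_apply]
    exact Finset.sum_congr rfl fun j _ => by simp [mul_comm]
  rw [hsum]
  refine Submodule.sum_mem _ fun j hj => Submodule.subset_span
    ⟨Polynomial.X ^ j, fun z => (P z).coeff j, ?_, LocConst.indCond α β (N := N) ?_ ?_, rfl⟩
  · simpa using Nat.lt_succ_iff.1 (Finset.mem_range.1 hj)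
  · exact fun x => ⟨N, fun y hy => by rw [hconst x y hy]⟩
  · exact fun z hz => by simp [hzero z hz]

lemma locConst_genjImageFun_zero (k : ℕ) (α β : L) :
    LocConst p L (genjImageFun p L k α β 0) := by
  refine fun x => ⟨0, fun y hy => ?_⟩
  simp only [Nat.cast_zero, neg_zero, zpow_zero] at hy
  rcases le_or_gt ‖x‖ 1 with hx | hx
  · have hy1 : ‖y‖ ≤ 1 := by
      simpa using Padic.norm_sub_le_trans (z := 0) hy (by simpa using hx)
    simp [genjImageFun, hx, hy1]
  · have hyx : ‖y‖ = ‖x‖ := Padic.norm_eq_of_norm_sub_le hy hx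
    have hx0 : x ≠ 0 := norm_pos_iff.1 (one_pos.trans hx)
    simp [genjImageFun, hyx, hx.not_ge, Padic.valuation_eq_of_norm_eq hx0 hyx.symm]

lemma genjImageFun_eq_pow_mul (k : ℕ) (α β : L) (j : ℕ) (z : ℚ_[p]) :
    genjImageFun p L k α β j z = iotaL p L z ^ j * genjImageFun p L k α β 0 z := by
  simp only [genjImageFun]
  split_ifs <;> ring

/-- Modulo compactly supported functions, `π(α)` is spanned by the images of the functions
`z^j 1_{ℤ_p}` under the intertwining operator. -/
lemma piRep_le_polC_sup_span {k : ℕ} {α β : L} (hα : α ≠ 0) (hβ : β ≠ 0) :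
    piRep p L k α β ≤ polC p L (k - 2) ⊔
      Submodule.span L {f | ∃ j ≤ k - 2, f = genjImageFun p L k α β j} := by
  refine Submodule.span_le.2 ?_
  rintro _ ⟨P, h, hP, ⟨hh, h', hh', hext⟩, rfl⟩
  have : CharZero L := charZero_of_injective_algebraMap (algebraMap ℚ_[p] L).injective
  have hp : (1 : ℝ) < p := by exact_mod_cast (Fact.out : p.Prime).one_lt
  have hpL : (p : L) ≠ 0 := by exact_mod_cast (Fact.out : p.Prime).ne_zero
  have hlam : α * (p : L) / β ≠ 0 := div_ne_zero (mul_ne_zero hα hpL) hβ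
  set g := genjImageFun p L k α β 0 with hg
  obtain ⟨n, hn⟩ := hh' 0
  have hsub : LocConst p L (fun z => h z - h' 0 * g z) := by
    have hgc : LocConst p L g := locConst_genjImageFun_zero k α β
    rw [locConst_iff_eventually] at hh hgc ⊢
    intro x
    filter_upwards [hh x, hgc x] with y hy hgy
    rw [hy, hgy]
  have hsupp : ∀ z : ℚ_[p], (p : ℝ) ^ (n : ℤ) < ‖z‖ → h z - h' 0 * g z = 0 := by
    intro z hz
    have hz1 : 1 < ‖z‖ := (one_le_zpow_natCast n).trans_lt hz
    have hz0 : z ≠ 0 := norm_pos_iff.1 (one_pos.trans hz1)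
    have h1 := hn z⁻¹ (by
      rw [sub_zero, norm_inv, zpow_neg]
      exact inv_anti₀ (by positivity) hz.le)
    rw [hext _ (inv_ne_zero hz0), inv_inv, Padic.valuation_inv, zpow_neg] at h1
    rw [← h1]
    simp only [hg, genjImageFun, hz1.not_ge, if_false, pow_zero, one_mul]
    field_simp
    simp
  have hdecomp : (fun z => Polynomial.eval (iotaL p L z) P * h z) =
      (fun z => Polynomial.eval (iotaL p L z) P * (h z - h' 0 * g z)) +
      ∑ j ∈ Finset.range (k - 2 + 1), (h' 0 * P.coeff j) • genjImageFun p L k α β j := by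
    funext z
    simp only [Pi.add_apply, Finset.sum_apply, Pi.smul_apply, smul_eq_mul]
    rw [Polynomial.eval_eq_sum_range' (Nat.lt_succ_of_le hP), mul_sub]
    have : ∑ j ∈ Finset.range (k - 2 + 1), h' 0 * P.coeff j * genjImageFun p L k α β j z =
        (∑ j ∈ Finset.range (k - 2 + 1), P.coeff j * iotaL p L z ^ j) * (h' 0 * g z) := by
      rw [Finset.sum_mul]
      refine Finset.sum_congr rfl fun j _ => ?_
      rw [genjImageFun_eq_pow_mul, ← hg]
      ring
    rw [this, sub_add_cancel]
  rw [hdecomp]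
  refine Submodule.add_mem_sup (isPolC_eval_mul hP hsub hsupp)
    (Submodule.sum_mem _ fun j hj => Submodule.smul_mem _ _ (Submodule.subset_span
      ⟨j, Nat.lt_succ_iff.1 (Finset.mem_range.1 hj), rfl⟩))

/-- The linear functional on `polC` given by a `PolCDual`. -/
def PolCDual.toLinearMap {d : ℕ} (μ : PolCDual p L d) : polC p L d →ₗ[L] L where
  toFun f := μ.toFun f
  map_add' f g := μ.map_add' f g f.2 g.2
  map_smul' c f := μ.map_smul' c f f.2

/-- The restriction of the intertwining operator to compactly supported functions. -/
def IopOk.restrict {k : ℕ} {α β : L} {Iop : (ℚ_[p] → L) → (ℚ_[p] → L)}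
    (hIop : IopOk p L k α β Iop) : polC p L (k - 2) →ₗ[L] (ℚ_[p] → L) where
  toFun f := Iop f
  map_add' f g := hIop.2.1 f (IsPolC.mem_piRep β α f.2) g (IsPolC.mem_piRep β α g.2)
  map_smul' c f := hIop.2.2.1 c f (IsPolC.mem_piRep β α f.2)

/-- Every element of `π(α)` is the sum of a compactly supported function and of the image
of a compactly supported function under the intertwining operator. -/
lemma IopOk.exists_eq_add {k : ℕ} {α β : L} {Iop : (ℚ_[p] → L) → (ℚ_[p] → L)}
    (hIop : IopOk p L k α β Iop) (hα : α ≠ 0) (hβ : β ≠ 0) {f : ℚ_[p] → L}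
    (hf : f ∈ piRep p L k α β) :
    ∃ c c' : ℚ_[p] → L, IsPolC p L (k - 2) c ∧ IsPolC p L (k - 2) c' ∧ f = c + Iop c' := by
  obtain ⟨c, hc, g, hg, rfl⟩ := Submodule.mem_sup.1 (piRep_le_polC_sup_span hα hβ hf)
  have hspan : Submodule.span L {f | ∃ j ≤ k - 2, f = genjImageFun p L k α β j} ≤
      LinearMap.range hIop.restrict := by
    refine Submodule.span_le.2 ?_
    rintro _ ⟨j, hj, rfl⟩
    exact ⟨⟨genjFun p L j, isPolC_genjFun hj⟩, hIop.2.2.2.2 j hj⟩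
  obtain ⟨c', rfl⟩ := hspan hg
  exact ⟨c, c', hc, c'.2, rfl⟩

lemma ne_zero_of_valL_pos {x : L} (h : 0 < valL p L x) : x ≠ 0 := by
  rintro rfl
  simp [valL] at h

/-- The normalizing constant of the compatibility relation does not vanish. -/
lemma Hyps.const_ne_zero {k : ℕ} {α β : L} (h : Hyps p L k α β) :
    (1 - α / β) / (1 - β / ((p : L) * α)) ≠ 0 := by
  obtain ⟨-, hne, hα, hβ, -, hle⟩ := h
  have hα0 := ne_zero_of_valL_pos hα
  have hβ0 := ne_zero_of_valL_pos hβ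
  have : CharZero L := charZero_of_injective_algebraMap (algebraMap ℚ_[p] L).injective
  have hp : (1 : ℝ) < p := by exact_mod_cast (Fact.out : p.Prime).one_lt
  have hpL : (p : L) ≠ 0 := by exact_mod_cast (Fact.out : p.Prime).ne_zero
  refine div_ne_zero (sub_ne_zero.2 fun h1 => hne ?_) (sub_ne_zero.2 fun h1 => ?_)
  · exact (eq_div_iff hβ0).1 h1 |>.symm.trans (one_mul β)
  · have hβα : β = (p : L) * α := by
      have := (eq_div_iff (mul_ne_zero hpL hα0)).1 h1
      rw [← this, one_mul]
    have hnorm : ‖(p : L)‖ = (p : ℝ)⁻¹ := by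
      rw [← map_natCast (algebraMap ℚ_[p] L) p, norm_algebraMap', Padic.norm_p]
    have hval : valL p L β = 1 + valL p L α := by
      rw [hβα, valL, valL, norm_mul, Real.logb_mul (norm_ne_zero_iff.2 hpL)
        (norm_ne_zero_iff.2 hα0), hnorm, Real.logb_inv, Real.logb_self_eq_one hp]
      ring
    linarith

end Extension

/-- Let `μ_α, μ_β` be linear functionals on `Pol^{k-2}(ℚ_p, L)` (the compactly
supported elements of `π(α)` and `π(β)`), satisfying
`μ_β(f) = ((1-α/β)/(1-β/(pα))) μ_α(I(f))` for every compactly supported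
`f ∈ π(β)` with `I(f)` compactly supported.  Then there is a unique pair of
linear functionals `μ̃_β` on `π(β)` and `μ̃_α` on `π(α)` extending `μ_β` and
`μ_α` such that `μ̃_β(f) = ((1-α/β)/(1-β/(pα))) μ̃_α(I(f))` for all `f ∈ π(β)`. -/
theorem statement17 (p : ℕ) [Fact p.Prime] (L : Type) [NontriviallyNormedField L]
    [NormedAlgebra ℚ_[p] L] [FiniteDimensional ℚ_[p] L] [IsUltrametricDist L]
    (k : ℕ) (α β : L) (h : Hyps p L k α β)
    (Iop : (ℚ_[p] → L) → (ℚ_[p] → L)) (hIop : IopOk p L k α β Iop)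
    (μα μβ : PolCDual p L (k - 2))
    (hcompat : ∀ f : ℚ_[p] → L, IsPolC p L (k - 2) f → IsPolC p L (k - 2) (Iop f) →
      μβ.toFun f = ((1 - α / β) / (1 - β / ((p : L) * α))) * μα.toFun (Iop f)) :
    ∃ Mβ Mα : (ℚ_[p] → L) → L,
      ((∀ f ∈ piRep p L k β α, ∀ g ∈ piRep p L k β α, Mβ (f + g) = Mβ f + Mβ g) ∧
       (∀ c : L, ∀ f ∈ piRep p L k β α, Mβ (c • f) = c * Mβ f) ∧
       (∀ f ∈ piRep p L k α β, ∀ g ∈ piRep p L k α β, Mα (f + g) = Mα f + Mα g) ∧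
       (∀ c : L, ∀ f ∈ piRep p L k α β, Mα (c • f) = c * Mα f) ∧
       (∀ f : ℚ_[p] → L, IsPolC p L (k - 2) f → Mβ f = μβ.toFun f) ∧
       (∀ f : ℚ_[p] → L, IsPolC p L (k - 2) f → Mα f = μα.toFun f) ∧
       (∀ f ∈ piRep p L k β α,
         Mβ f = ((1 - α / β) / (1 - β / ((p : L) * α))) * Mα (Iop f))) ∧
      ∀ Mβ' Mα' : (ℚ_[p] → L) → L,
        ((∀ f ∈ piRep p L k β α, ∀ g ∈ piRep p L k β α, Mβ' (f + g) = Mβ' f + Mβ' g) ∧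
         (∀ c : L, ∀ f ∈ piRep p L k β α, Mβ' (c • f) = c * Mβ' f) ∧
         (∀ f ∈ piRep p L k α β, ∀ g ∈ piRep p L k α β, Mα' (f + g) = Mα' f + Mα' g) ∧
         (∀ c : L, ∀ f ∈ piRep p L k α β, Mα' (c • f) = c * Mα' f) ∧
         (∀ f : ℚ_[p] → L, IsPolC p L (k - 2) f → Mβ' f = μβ.toFun f) ∧
         (∀ f : ℚ_[p] → L, IsPolC p L (k - 2) f → Mα' f = μα.toFun f) ∧
         (∀ f ∈ piRep p L k β α,
           Mβ' f = ((1 - α / β) / (1 - β / ((p : L) * α))) * Mα' (Iop f))) →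
        (∀ f ∈ piRep p L k β α, Mβ' f = Mβ f) ∧ (∀ f ∈ piRep p L k α β, Mα' f = Mα f) := by
  have hα0 : α ≠ 0 := ne_zero_of_valL_pos h.2.2.1
  have hβ0 : β ≠ 0 := ne_zero_of_valL_pos h.2.2.2.1
  set κ := (1 - α / β) / (1 - β / ((p : L) * α))
  have hκ : κ ≠ 0 := h.const_ne_zero
  let T : (polC p L (k - 2) × polC p L (k - 2)) →ₗ[L] (ℚ_[p] → L) :=
    (polC p L (k - 2)).subtype.coprod hIop.restrict
  let φ : (polC p L (k - 2) × polC p L (k - 2)) →ₗ[L] L :=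
    μα.toLinearMap.coprod (κ⁻¹ • μβ.toLinearMap)
  have hφ : φ ∈ (LinearMap.ker T).dualAnnihilator := by
    rw [Submodule.mem_dualAnnihilator]
    rintro ⟨c, c'⟩ hc
    have hI : Iop c' = (-1 : L) • (c : ℚ_[p] → L) := by
      rw [neg_one_smul]
      exact eq_neg_of_add_eq_zero_right hc
    have hneg : IsPolC p L (k - 2) (Iop c') := by
      rw [hI]
      exact (polC p L (k - 2)).smul_mem _ c.2
    change μα.toFun c + κ⁻¹ * μβ.toFun c' = 0
    rw [hcompat c' c'.2 hneg, hI, μα.map_smul' _ _ c.2]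
    field_simp
    ring
  rw [← LinearMap.range_dualMap_eq_dualAnnihilator_ker] at hφ
  obtain ⟨ψ, hψ⟩ := hφ
  have hψα : ∀ f : ℚ_[p] → L, IsPolC p L (k - 2) f → ψ f = μα.toFun f := fun f hf => by
    have h0 := LinearMap.congr_fun hψ (⟨f, hf⟩, 0)
    simp only [T, φ, LinearMap.dualMap_apply, LinearMap.coprod_apply, map_zero, add_zero] at h0
    exact h0
  have hψβ : ∀ f : ℚ_[p] → L, IsPolC p L (k - 2) f → κ * ψ (Iop f) = μβ.toFun f := fun f hf => by
    have h0 := LinearMap.congr_fun hψ (0, ⟨f, hf⟩)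
    simp only [T, φ, LinearMap.dualMap_apply, LinearMap.coprod_apply, map_zero, zero_add] at h0
    have h1 : ψ (Iop f) = κ⁻¹ * μβ.toFun f := h0
    rw [h1, mul_inv_cancel_left₀ hκ]
  refine ⟨fun f => κ * ψ (Iop f), ψ, ⟨?_, ?_, ?_, ?_, hψβ, hψα, fun _ _ => rfl⟩, ?_⟩
  · intro f hf g hg
    simp only [hIop.2.1 f hf g hg, map_add, mul_add]
  · intro c f hf
    simp only [hIop.2.2.1 c f hf, map_smul, smul_eq_mul]
    ring
  · exact fun f _ g _ => map_add ψ f g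
  · exact fun c f _ => map_smul ψ c f
  · rintro Mβ' Mα' ⟨-, -, hadd, -, hβ', hα', hrel⟩
    have huniq : ∀ f ∈ piRep p L k α β, Mα' f = ψ f := by
      intro f hf
      obtain ⟨c, c', hc, hc', rfl⟩ := hIop.exists_eq_add hα0 hβ0 hf
      have hc'β := hc'.mem_piRep (k := k) β α
      rw [hadd c (hc.mem_piRep α β) (Iop c') (hIop.1 c' hc'β), map_add, hα' c hc, hψα c hc]
      congr 1
      apply mul_left_cancel₀ hκ
      rw [← hrel c' hc'β, hβ' c' hc', hψβ c' hc']
    refine ⟨fun f hf => ?_, huniq⟩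
    rw [hrel f hf, huniq _ (hIop.1 f hf)]

end Paper

end
end
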